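/- Let u(x,t) = u_0(x − t) with u_0 : ℝ → ℝ of class C^{2k+2}, let u_h be a DG solution on [0,T] (with either the periodic upwind flux, u_0 being 2π-periodic, or the Dirichlet inflow flux), and suppose the initial value is u_h(·,0) = u_I^k(·,0) on Ω. Then there is a constant C depending only on k and the quasi-uniformity constant c such that for all j = 1,…,N and all t ∈ [0,T]: |(u − u_h)(x_{j+1/2}^-, t)| ≤ C t h^{2k+1/2} M_{2k+2}, and ( (1/N) Σ_{j=1}^N ((u − u_h)(x_{j+1/2}^-, t))² )^{1/2} ≤ C t h^{2k+1} M_{2k+2}, where (u − u_h)(x_{j+1/2}^-, t) = u(x_{j+1/2},t) − u_h(x_{j+1/2}^-,t). -/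

import Mathlib

open MeasureTheory intervalIntegral

/-- Legendre polynomial of degree `m` via the Rodrigues formula. -/
noncomputable def legendreP (m : ℕ) : ℝ → ℝ :=
  fun s => (1 / ((2:ℝ) ^ m * (Nat.factorial m : ℝ))) *
    iteratedDeriv m (fun t : ℝ => (t ^ 2 - 1) ^ m) s

/-- Legendre polynomial rescaled to the cell `(a, b)`. -/
noncomputable def legendreCell (m : ℕ) (a b : ℝ) : ℝ → ℝ :=
  fun x => legendreP m ((2 * x - (a + b)) / (b - a))

/-- `P` is the Gauss–Radau projection (onto polynomials of degree ≤ k on `(a,b)`) of `u`. -/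
def IsGRProj (k : ℕ) (a b : ℝ) (u : ℝ → ℝ) (P : Polynomial ℝ) : Prop :=
  P.natDegree ≤ k ∧
  (∀ v : Polynomial ℝ, v.natDegree + 1 ≤ k →
    (∫ x in a..b, P.eval x * v.eval x) = ∫ x in a..b, u x * v.eval x) ∧
  P.eval b = u b

/-- The scaled primitive `(D⁻¹ v)(x) = (2/(b-a)) ∫_a^x v`. -/
noncomputable def Dinv (a b : ℝ) (v : ℝ → ℝ) : ℝ → ℝ :=
  fun x => (2 / (b - a)) * ∫ t in a..x, v t

/-- `F` is the sequence of correction polynomials on the cell `(a,b)`: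
`F 1 = P_h^-(D⁻¹ L_k)` and `F i = -P_h^-(D⁻¹ F (i-1))` for `i ≥ 2`. -/
def IsFSeq (k : ℕ) (a b : ℝ) (F : ℕ → Polynomial ℝ) : Prop :=
  IsGRProj k a b (Dinv a b (legendreCell k a b)) (F 1) ∧
  ∀ i, 2 ≤ i → IsGRProj k a b (Dinv a b (fun x => (F (i-1)).eval x)) (-(F i))

/-- The `m`-th Radau coefficient of `w` on the cell `(a,b)`. -/
noncomputable def radauCoeff (a b : ℝ) (w : ℝ → ℝ) (m : ℕ) : ℝ :=
  w b - (1 / (b - a)) *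
    ∫ x in a..b, w x * ∑ l ∈ Finset.range m, (2 * (l:ℝ) + 1) * legendreCell l a b x

/-- `G_i(t) = (d/dt)^i u_{j,k+1}(t)` for `u(x,t) = u0(x - t)` on the cell `(a,b)`. -/
noncomputable def Gfun (k : ℕ) (a b : ℝ) (u0 : ℝ → ℝ) (i : ℕ) (t : ℝ) : ℝ :=
  iteratedDeriv i (fun s => radauCoeff a b (fun y => u0 (y - s)) (k + 1)) t

/-- `w_i(x,t) = (h_j/2)^i G_i(t) F_i(x)` on the cell `(a,b)`. -/
noncomputable def wFun (k : ℕ) (a b : ℝ) (u0 : ℝ → ℝ) (F : ℕ → Polynomial ℝ)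
    (i : ℕ) (y t : ℝ) : ℝ :=
  ((b - a) / 2) ^ i * Gfun k a b u0 i t * (F i).eval y

/-- `w^l = Σ_{i=1}^l w_i` on the cell `(a,b)`. -/
noncomputable def wSum (k : ℕ) (a b : ℝ) (u0 : ℝ → ℝ) (F : ℕ → Polynomial ℝ)
    (l : ℕ) (y t : ℝ) : ℝ :=
  ∑ i ∈ Finset.Icc 1 l, wFun k a b u0 F i y t

/-- The interpolation function `u_I^l = P_h^- u - w^l` on the cell `(a,b)`;
here `P t` is the Gauss–Radau projection of `u(·,t)`. -/
noncomputable def uIl (k : ℕ) (a b : ℝ) (u0 : ℝ → ℝ) (P : ℝ → Polynomial ℝ)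
    (F : ℕ → Polynomial ℝ) (l : ℕ) (y t : ℝ) : ℝ :=
  (P t).eval y - wSum k a b u0 F l y t

/-- `uh` is a DG solution on `[0,T]` on the mesh `x 0 < x 1 < … < x N`
(the piece on the cell `τ_j = (x (j-1), x j)` is the polynomial `uh j t`),
with prescribed inflow value `inflow t` at the left boundary. -/
def IsDGSol (k N : ℕ) (x : ℕ → ℝ) (T : ℝ) (inflow : ℝ → ℝ)
    (uh : ℕ → ℝ → Polynomial ℝ) : Prop :=
  (∀ j ∈ Finset.Icc 1 N, ∀ t : ℝ, (uh j t).natDegree ≤ k) ∧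
  (∀ j ∈ Finset.Icc 1 N, ∀ y : ℝ, ContDiff ℝ 1 (fun t => (uh j t).eval y)) ∧
  (∀ j ∈ Finset.Icc 1 N, ∀ t ∈ Set.Icc (0:ℝ) T, ∀ v : Polynomial ℝ, v.natDegree ≤ k →
    (∫ y in (x (j-1))..(x j), deriv (fun s => (uh j s).eval y) t * v.eval y)
      - (∫ y in (x (j-1))..(x j), (uh j t).eval y * v.derivative.eval y)
      + (uh j t).eval (x j) * v.eval (x j)
      - (if j = 1 then inflow t else (uh (j-1) t).eval (x (j-1))) * v.eval (x (j-1)) = 0)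

/-- The error `u - u_I^l` on the cell `τ_j`, as a function of `(y, s)`. -/
noncomputable def errFun (k l : ℕ) (x : ℕ → ℝ) (u0 : ℝ → ℝ)
    (P : ℕ → ℝ → Polynomial ℝ) (F : ℕ → ℕ → Polynomial ℝ) (j : ℕ) (y s : ℝ) : ℝ :=
  u0 (y - s) - uIl k (x (j-1)) (x j) u0 (P j) (F j) l y s


open MeasureTheory intervalIntegral

section Legendre
open Polynomial

/-- Legendre polynomial as a polynomial. -/
noncomputable def legPoly (m : ℕ) : ℝ[X] :=
  C (1 / ((2:ℝ) ^ m * (Nat.factorial m : ℝ))) * derivative^[m] ((X ^ 2 - 1) ^ m)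

theorem iteratedDeriv_poly (m : ℕ) (p : ℝ[X]) :
    iteratedDeriv m (fun t : ℝ => p.eval t) = fun t => (derivative^[m] p).eval t := by
  induction m with
  | zero => simp
  | succ n ih =>
    rw [iteratedDeriv_succ, ih]
    funext t
    rw [Polynomial.deriv, Function.iterate_succ_apply']

theorem legendreP_eq (m : ℕ) (s : ℝ) : legendreP m s = (legPoly m).eval s := by
  have h := iteratedDeriv_poly m ((X ^ 2 - 1) ^ m)
  have h2 : (fun t : ℝ => ((X ^ 2 - 1 : ℝ[X]) ^ m).eval t) = fun t : ℝ => (t ^ 2 - 1) ^ m := by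
    funext t; simp
  rw [h2] at h
  simp only [legendreP, legPoly, h, eval_mul, eval_C]

theorem eval_iter_deriv (r : ℝ) (n : ℕ) (p : ℝ[X]) :
    (derivative^[n] p).eval r = (n.factorial : ℝ) * (taylor r p).coeff n := by
  rw [taylor_coeff, ← factorial_smul_hasseDeriv]
  simp

theorem taylor_one_base (m : ℕ) :
    taylor (1:ℝ) ((X ^ 2 - 1) ^ m) = X ^ m * (X + C 2) ^ m := by
  rw [taylor_apply, ← mul_pow]
  simp only [pow_comp, sub_comp, X_comp, one_comp]
  congr 1
  have : (C (2:ℝ)) = 2 := rfl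
  rw [this, map_one]; ring

theorem taylor_neg_one_base (m : ℕ) :
    taylor (-1:ℝ) ((X ^ 2 - 1) ^ m) = X ^ m * (X - C 2) ^ m := by
  rw [taylor_apply, ← mul_pow]
  simp only [pow_comp, sub_comp, X_comp, one_comp]
  congr 1
  have : (C (2:ℝ)) = 2 := rfl
  rw [this, map_neg, map_one]; ring

theorem legPoly_one (m : ℕ) : (legPoly m).eval 1 = 1 := by
  rw [legPoly, eval_mul, eval_iter_deriv, taylor_one_base]
  have : (X ^ m * (X + C (2:ℝ)) ^ m).coeff m = 2 ^ m := by
    rw [mul_comm, coeff_mul_X_pow', if_pos le_rfl, Nat.sub_self, coeff_zero_eq_eval_zero]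
    simp
  rw [this, eval_C]
  have h1 : (m.factorial : ℝ) ≠ 0 := by positivity
  field_simp

theorem legPoly_neg_one_sq (m : ℕ) : (legPoly m).eval (-1) ^ 2 = 1 := by
  rw [legPoly, eval_mul, eval_iter_deriv, taylor_neg_one_base]
  have : (X ^ m * (X - C (2:ℝ)) ^ m).coeff m = (-2) ^ m := by
    rw [mul_comm, coeff_mul_X_pow', if_pos le_rfl, Nat.sub_self, coeff_zero_eq_eval_zero]
    simp
  rw [this, eval_C]
  have h1 : (m.factorial : ℝ) ≠ 0 := by positivity
  have h2 : ((-2:ℝ) ^ m) ^ 2 = (2 ^ m) ^ 2 := by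
    rw [← pow_mul, ← pow_mul, mul_comm, pow_mul, pow_mul]; norm_num
  field_simp
  rw [h2]

theorem base_bdry_one (m i : ℕ) (hi : i < m) :
    (derivative^[i] ((X ^ 2 - 1 : ℝ[X]) ^ m)).eval 1 = 0 := by
  rw [eval_iter_deriv, taylor_one_base, mul_comm (X ^ m), coeff_mul_X_pow', if_neg (by omega),
    mul_zero]

theorem base_bdry_neg_one (m i : ℕ) (hi : i < m) :
    (derivative^[i] ((X ^ 2 - 1 : ℝ[X]) ^ m)).eval (-1) = 0 := by
  rw [eval_iter_deriv, taylor_neg_one_base, mul_comm (X ^ m), coeff_mul_X_pow',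
    if_neg (by omega), mul_zero]

theorem poly_ii (p : ℝ[X]) (a b : ℝ) : IntervalIntegrable (fun x => p.eval x) volume a b :=
  p.continuous.intervalIntegrable a b

theorem poly_ibp (p q : ℝ[X]) (a b : ℝ) :
    ∫ x in a..b, p.eval x * q.derivative.eval x =
      p.eval b * q.eval b - p.eval a * q.eval a - ∫ x in a..b, p.derivative.eval x * q.eval x :=
  integral_mul_deriv_eq_deriv_mul (fun x _ => p.hasDerivAt x) (fun x _ => q.hasDerivAt x)
    (poly_ii _ _ _) (poly_ii _ _ _)

theorem legPoly_natDegree (m : ℕ) : (legPoly m).natDegree ≤ m := by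
  refine (natDegree_C_mul_le _ _).trans ((natDegree_iterate_derivative _ _).trans ?_)
  have : ((X ^ 2 - 1 : ℝ[X]) ^ m).natDegree ≤ m * 2 := by
    refine natDegree_pow_le_of_le m ?_
    compute_degree
  omega

theorem base_orth (m i : ℕ) (hi : i ≤ m) (q : ℝ[X]) :
    ∫ x in (-1:ℝ)..1, (derivative^[i] ((X ^ 2 - 1 : ℝ[X]) ^ m)).eval x * q.eval x =
      (-1) ^ i * ∫ x in (-1:ℝ)..1, ((X ^ 2 - 1 : ℝ[X]) ^ m).eval x * (derivative^[i] q).eval x := by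
  induction i generalizing q with
  | zero => simp
  | succ n ih =>
    have h := poly_ibp (derivative^[n] ((X ^ 2 - 1 : ℝ[X]) ^ m)) q (-1) 1
    rw [base_bdry_one m n (by omega), base_bdry_neg_one m n (by omega), ih (by omega)] at h
    simp only [Function.iterate_succ_apply'] at *
    rw [← Function.iterate_succ_apply, Function.iterate_succ_apply'] at h
    rw [pow_succ (-1:ℝ) n]
    linarith

theorem legPoly_orth (m : ℕ) (q : ℝ[X]) (hq : q.natDegree < m) :
    ∫ x in (-1:ℝ)..1, (legPoly m).eval x * q.eval x = 0 := by
  have h := base_orth m m le_rfl q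
  rw [iterate_derivative_eq_zero hq] at h
  simp only [eval_zero, mul_zero, intervalIntegral.integral_zero] at h
  simp only [legPoly, eval_mul, eval_C, mul_assoc]
  rw [intervalIntegral.integral_const_mul]
  rw [h, mul_zero]

theorem natDegree_drop (p : ℝ[X]) (n : ℕ) (h1 : p.natDegree ≤ n + 1) (h2 : p.coeff (n+1) = 0) :
    p.natDegree ≤ n := by
  by_contra hcon
  have he : p.natDegree = n + 1 := by omega
  rw [← he, coeff_natDegree, leadingCoeff_eq_zero] at h2
  rw [h2] at he
  simp at he

theorem legPoly_norm (m : ℕ) :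
    ∫ x in (-1:ℝ)..1, (legPoly m).eval x * (legPoly m).eval x = 2 / (2 * (m:ℝ) + 1) := by
  set L := legPoly m with hL
  set I := ∫ x in (-1:ℝ)..1, L.eval x * L.eval x with hI
  -- lower order part
  have hlow : ∫ x in (-1:ℝ)..1, L.eval x * (X * derivative L - C (m:ℝ) * L).eval x = 0 := by
    rcases Nat.eq_zero_or_pos m with h0 | hpos
    · have : L.natDegree = 0 := by have := legPoly_natDegree m; rw [← hL] at this; omega
      have h2 : derivative L = 0 := derivative_of_natDegree_zero this
      simp [h2, h0]
    · refine legPoly_orth m _ ?_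
      have hd : (X * derivative L - C (m:ℝ) * L).natDegree ≤ m := by
        refine (natDegree_sub_le _ _).trans (max_le ?_ ?_)
        · refine natDegree_mul_le.trans ?_
          have := natDegree_derivative_le L
          have := legPoly_natDegree m
          have := natDegree_X (R := ℝ)
          rw [← hL] at *
          omega
        · exact (natDegree_C_mul_le _ _).trans (legPoly_natDegree m)
      obtain ⟨n, rfl⟩ : ∃ n, m = n + 1 := ⟨m - 1, by omega⟩
      refine Nat.lt_succ_of_le (natDegree_drop _ n hd ?_)
      rw [coeff_sub, coeff_X_mul, coeff_derivative, coeff_C_mul]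
      push_cast; ring
  have h1 := poly_ibp (X * L) L (-1) 1
  have hc : Continuous fun x : ℝ => L.eval x * (X * derivative L).eval x := by fun_prop
  have e1 : ∫ x in (-1:ℝ)..1, L.eval x * (X * derivative L - C (m:ℝ) * L).eval x
      = (∫ x in (-1:ℝ)..1, L.eval x * (X * derivative L).eval x) - m * I := by
    rw [hI, ← intervalIntegral.integral_const_mul, ← intervalIntegral.integral_sub]
    · congr 1; funext x; simp; ring
    · exact Continuous.intervalIntegrable (by fun_prop) _ _
    · exact Continuous.intervalIntegrable (by fun_prop) _ _
  have e2 : ∫ x in (-1:ℝ)..1, (derivative (X * L)).eval x * L.eval x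
      = I + ∫ x in (-1:ℝ)..1, L.eval x * (X * derivative L).eval x := by
    rw [hI, ← intervalIntegral.integral_add]
    · congr 1; funext x; simp; ring
    · exact Continuous.intervalIntegrable (by fun_prop) _ _
    · exact Continuous.intervalIntegrable (by fun_prop) _ _
  have e3 : ∫ x in (-1:ℝ)..1, (X * L).eval x * (derivative L).eval x
      = ∫ x in (-1:ℝ)..1, L.eval x * (X * derivative L).eval x := by
    congr 1; funext x; simp; ring
  rw [e2, e3] at h1
  rw [e1] at hlow
  have b1 := legPoly_one m
  have b2 := legPoly_neg_one_sq m
  set J := ∫ x in (-1:ℝ)..1, L.eval x * (X * derivative L).eval x with hJ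
  rw [← hL] at b1 b2
  rw [eval_mul, eval_mul, eval_X, eval_X, b1] at h1
  rw [eq_div_iff (by positivity)]
  nlinarith

/-- Legendre polynomial on the cell. -/
noncomputable def legC (a b : ℝ) (m : ℕ) : ℝ[X] :=
  (legPoly m).comp (C (2 / (b - a)) * X - C ((a + b) / (b - a)))

theorem legC_eval (a b : ℝ) (m : ℕ) (x : ℝ) : (legC a b m).eval x = legendreCell m a b x := by
  rw [legendreCell, legendreP_eq, legC, eval_comp]
  congr 1
  simp
  ring

theorem legC_natDegree (a b : ℝ) (m : ℕ) : (legC a b m).natDegree ≤ m := by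
  refine natDegree_comp_le.trans ?_
  have h1 : (C (2 / (b - a)) * X - C ((a + b) / (b - a)) : ℝ[X]).natDegree ≤ 1 := by
    compute_degree
  calc _ ≤ m * 1 := Nat.mul_le_mul (legPoly_natDegree m) h1
    _ = m := by ring

theorem legC_b {a b : ℝ} (hab : a < b) (m : ℕ) : (legC a b m).eval b = 1 := by
  rw [legC_eval, legendreCell, legendreP_eq]
  have : (2 * b - (a + b)) / (b - a) = 1 := by
    rw [div_eq_one_iff_eq (by linarith)]; ring
  rw [this, legPoly_one]

theorem cell_subst {a b : ℝ} (hab : a < b) (f : ℝ → ℝ) :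
    ∫ x in a..b, f ((2 / (b - a)) * x - (a + b) / (b - a)) = (b - a) / 2 * ∫ s in (-1:ℝ)..1, f s := by
  have hne : b - a ≠ 0 := by linarith
  rw [intervalIntegral.integral_comp_mul_sub f (by positivity)]
  have e1 : 2 / (b - a) * a - (a + b) / (b - a) = -1 := by field_simp; ring
  have e2 : 2 / (b - a) * b - (a + b) / (b - a) = 1 := by field_simp; ring
  rw [e1, e2, inv_div, smul_eq_mul]

theorem legC_norm {a b : ℝ} (hab : a < b) (m : ℕ) :
    ∫ x in a..b, (legC a b m).eval x * (legC a b m).eval x = (b - a) / (2 * (m:ℝ) + 1) := by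
  have h := cell_subst hab (fun s => (legPoly m).eval s * (legPoly m).eval s)
  rw [legPoly_norm] at h
  simp only [legC, eval_comp, eval_sub, eval_mul, eval_C, eval_X]
  rw [h]; ring

theorem legC_orth {a b : ℝ} (hab : a < b) (m : ℕ) (q : ℝ[X]) (hq : q.natDegree < m) :
    ∫ x in a..b, (legC a b m).eval x * q.eval x = 0 := by
  set r : ℝ[X] := q.comp (C ((b - a)/2) * X + C ((a + b) / 2)) with hr
  have hne : b - a ≠ 0 := by linarith
  have hrd : r.natDegree < m := by
    refine lt_of_le_of_lt natDegree_comp_le ?_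
    have h1 : (C ((b - a)/2) * X + C ((a + b) / 2) : ℝ[X]).natDegree ≤ 1 := by
      compute_degree
    calc _ ≤ q.natDegree * 1 := Nat.mul_le_mul le_rfl h1
      _ < m := by omega
  have h := cell_subst hab (fun s => (legPoly m).eval s * r.eval s)
  rw [legPoly_orth m r hrd, mul_zero] at h
  rw [← h]
  congr 1
  funext x
  simp only [legC, hr, eval_comp, eval_sub, eval_mul, eval_add, eval_C, eval_X]
  congr 2
  field_simp
  ring

theorem legC_bound (m : ℕ) : ∃ B : ℝ, 0 ≤ B ∧ ∀ a b : ℝ, a < b → ∀ x ∈ Set.Icc a b,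
    |(legC a b m).eval x| ≤ B := by
  obtain ⟨B, hB⟩ := (isCompact_Icc (a := (-1:ℝ)) (b := 1)).exists_bound_of_continuousOn
    (legPoly m).continuous.continuousOn
  refine ⟨B, (norm_nonneg _).trans (hB 1 (by norm_num)), fun a b hab x hx => ?_⟩
  rw [legC_eval, legendreCell, legendreP_eq]
  refine hB _ ⟨?_, ?_⟩
  · rw [le_div_iff₀ (by linarith)]; linarith [hx.1]
  · rw [div_le_iff₀ (by linarith)]; linarith [hx.2]

theorem legC_coeff_ne {a b : ℝ} (hab : a < b) (m : ℕ) : (legC a b m).coeff m ≠ 0 := by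
  intro h0
  have hn := legC_norm hab m
  by_cases hm : (legC a b m).natDegree < m
  · rw [legC_orth hab m _ hm] at hn
    have : 0 < (b - a) / (2 * (m:ℝ) + 1) := by
      have : 0 < b - a := by linarith
      positivity
    linarith
  · have he : (legC a b m).natDegree = m := le_antisymm (legC_natDegree a b m) (by omega)
    have : legC a b m = 0 := by
      rw [← leadingCoeff_eq_zero, leadingCoeff, he, h0]
    have hb := legC_b hab m
    rw [this] at hb
    simp at hb

theorem legC_span {a b : ℝ} (hab : a < b) (k : ℕ) (p : ℝ[X]) (hp : p.natDegree ≤ k) :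
    ∃ c : ℕ → ℝ, p = ∑ l ∈ Finset.range (k+1), C (c l) * legC a b l := by
  induction k generalizing p with
  | zero =>
    refine ⟨fun _ => p.coeff 0 / (legC a b 0).coeff 0, ?_⟩
    have h1 := eq_C_of_natDegree_le_zero hp
    have h2 := eq_C_of_natDegree_le_zero (legC_natDegree a b 0)
    have h3 := legC_coeff_ne hab 0
    simp only [zero_add, Finset.sum_range_one]
    rw [h2, ← C_mul]
    simp only [coeff_C_zero]
    rw [div_mul_cancel₀ _ h3]
    exact h1
  | succ n ih =>
    set c0 := p.coeff (n+1) / (legC a b (n+1)).coeff (n+1) with hc0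
    have hd : (p - C c0 * legC a b (n+1)).natDegree ≤ n := by
      refine natDegree_drop _ n ((natDegree_sub_le _ _).trans (max_le hp
        ((natDegree_C_mul_le _ _).trans (legC_natDegree a b _)))) ?_
      rw [coeff_sub, coeff_C_mul, hc0, div_mul_cancel₀ _ (legC_coeff_ne hab _), sub_self]
    obtain ⟨c, hc⟩ := ih _ hd
    refine ⟨fun l => if l = n + 1 then c0 else c l, ?_⟩
    rw [Finset.sum_range_succ]
    simp only [if_pos]
    have : ∑ l ∈ Finset.range (n+1), C (if l = n + 1 then c0 else c l) * legC a b l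
        = ∑ l ∈ Finset.range (n+1), C (c l) * legC a b l := by
      refine Finset.sum_congr rfl fun l hl => ?_
      rw [if_neg]
      have := Finset.mem_range.1 hl
      omega
    rw [this, ← hc]
    ring

theorem legC_orth' {a b : ℝ} (hab : a < b) (m l : ℕ) (h : m ≠ l) :
    ∫ x in a..b, (legC a b m).eval x * (legC a b l).eval x = 0 := by
  rcases lt_or_gt_of_ne h with h1 | h1
  · simp_rw [mul_comm (eval _ (legC a b m))]
    exact legC_orth hab l _ (lt_of_le_of_lt (legC_natDegree a b m) h1)
  · exact legC_orth hab m _ (lt_of_le_of_lt (legC_natDegree a b l) h1)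

/-- Legendre coefficient -/
noncomputable def legCoef (a b : ℝ) (f : ℝ → ℝ) (l : ℕ) : ℝ :=
  (2 * (l:ℝ) + 1) / (b - a) * ∫ x in a..b, f x * (legC a b l).eval x

theorem legC_expand {a b : ℝ} (hab : a < b) (k : ℕ) (p : ℝ[X]) (hp : p.natDegree ≤ k) :
    p = ∑ l ∈ Finset.range (k+1), C (legCoef a b (fun x => p.eval x) l) * legC a b l := by
  obtain ⟨c, hc⟩ := legC_span hab k p hp
  have key : ∀ l ∈ Finset.range (k+1), legCoef a b (fun x => p.eval x) l = c l := by
    intro l hl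
    have : ∫ x in a..b, p.eval x * (legC a b l).eval x = c l * ((b - a) / (2 * (l:ℝ) + 1)) := by
      rw [hc]
      simp only [eval_finsetSum, eval_mul, eval_C, Finset.sum_mul]
      rw [intervalIntegral.integral_finsetSum]
      · rw [Finset.sum_eq_single_of_mem l hl]
        · simp only [mul_assoc]
          rw [intervalIntegral.integral_const_mul, legC_norm hab]
        · intro i _ hi
          simp only [mul_assoc]
          rw [intervalIntegral.integral_const_mul, legC_orth' hab _ _ hi, mul_zero]
      · intro i _
        exact Continuous.intervalIntegrable (by fun_prop) _ _
    rw [legCoef, this]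
    have hne : b - a ≠ 0 := by linarith
    field_simp
  conv_lhs => rw [hc]
  exact Finset.sum_congr rfl fun l hl => by rw [key l hl]

theorem radauCoeff_eq (a b : ℝ) (w : ℝ → ℝ) (hw : Continuous w) (m : ℕ) :
    radauCoeff a b w m = w b - ∑ l ∈ Finset.range m, legCoef a b w l := by
  unfold radauCoeff legCoef
  congr 1
  simp only [← legC_eval, Finset.mul_sum]
  rw [intervalIntegral.integral_finsetSum]
  · rw [Finset.mul_sum]
    refine Finset.sum_congr rfl fun l _ => ?_
    rw [← intervalIntegral.integral_const_mul, ← intervalIntegral.integral_const_mul]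
    congr 1; funext x; ring
  · intro i _
    exact Continuous.intervalIntegrable (by fun_prop) _ _

theorem radauCoeff_poly {a b : ℝ} (hab : a < b) (k : ℕ) (p : ℝ[X]) (hp : p.natDegree ≤ k) :
    radauCoeff a b (fun x => p.eval x) (k+1) = 0 := by
  rw [radauCoeff_eq _ _ _ p.continuous]
  have h := congrArg (eval b) (legC_expand hab k p hp)
  simp only [eval_finsetSum, eval_mul, eval_C, legC_b hab, mul_one] at h
  linarith

end Legendre

open MeasureTheory intervalIntegral

section Radau
open Polynomial

theorem gr_coef {k : ℕ} {a b : ℝ} {u : ℝ → ℝ} {P : ℝ[X]} (hP : IsGRProj k a b u P) (l : ℕ)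
    (hl : l < k) : legCoef a b (fun x => P.eval x) l = legCoef a b u l := by
  unfold legCoef
  rw [hP.2.1 (legC a b l) (by have := legC_natDegree a b l; omega)]

theorem gr_expand {k : ℕ} {a b : ℝ} (hab : a < b) {u : ℝ → ℝ} {P : ℝ[X]}
    (hP : IsGRProj k a b u P) :
    P = ∑ l ∈ Finset.range k, C (legCoef a b u l) * legC a b l
      + C (u b - ∑ l ∈ Finset.range k, legCoef a b u l) * legC a b k := by
  have h := legC_expand hab k P hP.1
  have hb := congrArg (eval b) h
  simp only [eval_finsetSum, eval_mul, eval_C, legC_b hab, mul_one] at hb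
  rw [Finset.sum_range_succ] at h hb
  rw [Finset.sum_congr rfl fun l hl => gr_coef hP l (Finset.mem_range.1 hl)] at hb
  rw [Finset.sum_congr rfl fun l hl => by rw [gr_coef hP l (Finset.mem_range.1 hl)]] at h
  rw [hP.2.2] at hb
  conv_lhs => rw [h]
  rw [hb]
  congr 3
  ring

theorem gr_orth {k : ℕ} (hk : 1 ≤ k) {a b : ℝ} (hab : a < b) {u : ℝ → ℝ} (hu : Continuous u)
    {P : ℝ[X]} (hP : IsGRProj k a b u P) (v : ℝ[X]) (hv : v.natDegree ≤ k) :
    ∫ x in a..b, P.eval x * v.eval x = (∫ x in a..b, u x * v.eval x)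
      + radauCoeff a b u (k+1) * ∫ x in a..b, (legC a b k).eval x * v.eval x := by
  obtain ⟨n, rfl⟩ : ∃ n, k = n + 1 := ⟨k - 1, by omega⟩
  set c := v.coeff (n+1) / (legC a b (n+1)).coeff (n+1) with hc
  set r := v - C c * legC a b (n+1) with hr
  have hrd : r.natDegree ≤ n := by
    refine natDegree_drop _ n ((natDegree_sub_le _ _).trans (max_le hv
        ((natDegree_C_mul_le _ _).trans (legC_natDegree a b _)))) ?_
    rw [coeff_sub, coeff_C_mul, hc, div_mul_cancel₀ _ (legC_coeff_ne hab _), sub_self]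
  have hve : ∀ x, v.eval x = c * (legC a b (n+1)).eval x + r.eval x := by
    intro x; rw [hr]; simp
  have split : ∀ f : ℝ → ℝ, Continuous f → ∫ x in a..b, f x * v.eval x =
      c * (∫ x in a..b, f x * (legC a b (n+1)).eval x) + ∫ x in a..b, f x * r.eval x := by
    intro f hf
    rw [← intervalIntegral.integral_const_mul, ← intervalIntegral.integral_add]
    · congr 1; funext x; rw [hve]; ring
    · exact Continuous.intervalIntegrable (by fun_prop) _ _
    · exact Continuous.intervalIntegrable (by fun_prop) _ _
  rw [split _ P.continuous, split _ hu, split _ (legC a b (n+1)).continuous, legC_norm hab,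
    legC_orth hab _ r (by omega), hP.2.1 r (by omega)]
  have h0 := radauCoeff_poly hab (n+1) P hP.1
  have h1 : radauCoeff a b u (n+1+1) =
      legCoef a b (fun x => P.eval x) (n+1) - legCoef a b u (n+1) := by
    rw [radauCoeff_eq _ _ _ P.continuous, Finset.sum_range_succ,
      Finset.sum_congr rfl fun l hl => gr_coef hP l (Finset.mem_range.1 hl), hP.2.2] at h0
    rw [radauCoeff_eq _ _ _ hu, Finset.sum_range_succ]
    linarith
  rw [h1]
  unfold legCoef
  have hne : b - a ≠ 0 := by linarith
  have hne2 : 2 * ((n+1:ℕ):ℝ) + 1 ≠ 0 := by positivity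
  field_simp
  ring

theorem legCoef_bound (k : ℕ) : ∃ B : ℝ, 0 ≤ B ∧ ∀ a b : ℝ, a < b → ∀ (u : ℝ → ℝ) (A : ℝ),
    (∀ x ∈ Set.Icc a b, |u x| ≤ A) → ∀ l ≤ k, |legCoef a b u l| ≤ B * A := by
  choose Bf hB0 hB using legC_bound
  refine ⟨∑ l ∈ Finset.range (k+1), (2 * (l:ℝ) + 1) * Bf l,
    Finset.sum_nonneg fun l _ => mul_nonneg (by positivity) (hB0 l), ?_⟩
  intro a b hab u A hA l hl
  have hA0 : 0 ≤ A := (abs_nonneg _).trans (hA a ⟨le_rfl, hab.le⟩)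
  have h1 : |∫ x in a..b, u x * (legC a b l).eval x| ≤ A * Bf l * |b - a| := by
    rw [← Real.norm_eq_abs]
    refine intervalIntegral.norm_integral_le_of_norm_le_const fun x hx => ?_
    rw [Set.uIoc_of_le hab.le] at hx
    have hx' : x ∈ Set.Icc a b := ⟨hx.1.le, hx.2⟩
    rw [Real.norm_eq_abs, abs_mul]
    exact mul_le_mul (hA x hx') (hB l a b hab x hx') (abs_nonneg _) hA0
  have hp : 0 < b - a := by linarith
  rw [abs_of_pos hp] at h1
  have h2 : |legCoef a b u l| ≤ (2 * (l:ℝ) + 1) * Bf l * A := by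
    unfold legCoef
    rw [abs_mul, abs_of_pos (by positivity)]
    calc _ ≤ (2 * (l:ℝ) + 1) / (b - a) * (A * Bf l * (b - a)) := by gcongr
      _ = _ := by field_simp
  refine h2.trans (mul_le_mul_of_nonneg_right ?_ hA0)
  exact Finset.single_le_sum (f := fun l : ℕ => (2 * (l:ℝ) + 1) * Bf l)
    (fun l _ => mul_nonneg (by positivity) (hB0 l)) (Finset.mem_range.2 (by omega))

theorem radau_bound (k : ℕ) : ∃ B : ℝ, 0 ≤ B ∧ ∀ a b : ℝ, a < b → ∀ (u : ℝ → ℝ) (A : ℝ),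
    Continuous u → (∀ x ∈ Set.Icc a b, |u x| ≤ A) → ∀ m ≤ k,
      |u b - ∑ l ∈ Finset.range m, legCoef a b u l| ≤ B * A := by
  obtain ⟨B, hB0, hB⟩ := legCoef_bound k
  refine ⟨1 + k * B, by positivity, fun a b hab u A hu hA m hm => ?_⟩
  have hA0 : 0 ≤ A := (abs_nonneg _).trans (hA a ⟨le_rfl, hab.le⟩)
  have h1 : |∑ l ∈ Finset.range m, legCoef a b u l| ≤ m * (B * A) := by
    refine (Finset.abs_sum_le_sum_abs _ _).trans ?_
    refine (Finset.sum_le_sum fun l hl => hB a b hab u A hA l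
      (by have := Finset.mem_range.1 hl; omega)).trans ?_
    simp
  have h2 : (m:ℝ) * (B * A) ≤ k * (B * A) :=
    mul_le_mul_of_nonneg_right (by exact_mod_cast hm) (by positivity)
  have h3 := hA b ⟨hab.le, le_rfl⟩
  calc _ ≤ |u b| + |∑ l ∈ Finset.range m, legCoef a b u l| := abs_sub _ _
    _ ≤ _ := by linarith

theorem gr_bound (k : ℕ) : ∃ B : ℝ, 0 ≤ B ∧ ∀ a b : ℝ, a < b → ∀ (u : ℝ → ℝ) (A : ℝ),
    Continuous u → (∀ x ∈ Set.Icc a b, |u x| ≤ A) → ∀ P : ℝ[X], IsGRProj k a b u P →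
    ∀ x ∈ Set.Icc a b, |P.eval x| ≤ B * A := by
  obtain ⟨B, hB0, hB⟩ := legCoef_bound k
  obtain ⟨R, hR0, hR⟩ := radau_bound k
  choose Bf hBf0 hBf using legC_bound
  refine ⟨∑ l ∈ Finset.range k, B * Bf l + R * Bf k, add_nonneg (Finset.sum_nonneg fun l _ =>
    mul_nonneg hB0 (hBf0 l)) (mul_nonneg hR0 (hBf0 k)), ?_⟩
  intro a b hab u A hu hA P hP x hx
  have hA0 : 0 ≤ A := (abs_nonneg _).trans (hA a ⟨le_rfl, hab.le⟩)
  rw [gr_expand hab hP]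
  simp only [eval_add, eval_finsetSum, eval_mul, eval_C]
  refine (abs_add_le _ _).trans ?_
  rw [add_mul, Finset.sum_mul]
  refine add_le_add ((Finset.abs_sum_le_sum_abs _ _).trans (Finset.sum_le_sum fun l hl => ?_)) ?_
  · rw [abs_mul]
    calc _ ≤ (B * A) * Bf l := mul_le_mul (hB a b hab u A hA l
          (by have := Finset.mem_range.1 hl; omega)) (hBf l a b hab x hx) (abs_nonneg _)
          (by positivity)
      _ = _ := by ring
  · rw [abs_mul]
    calc _ ≤ (R * A) * Bf k := mul_le_mul (hR a b hab u A hu hA k le_rfl)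
          (hBf k a b hab x hx) (abs_nonneg _) (by positivity)
      _ = _ := by ring

theorem radau_taylor (k : ℕ) : ∃ B : ℝ, 0 ≤ B ∧ ∀ a b : ℝ, a < b → ∀ (g : ℝ → ℝ) (A : ℝ),
    ContDiff ℝ (k+1) g → (∀ x ∈ Set.Icc a b, |iteratedDeriv (k+1) g x| ≤ A) →
      |radauCoeff a b g (k+1)| ≤ B * A * (b - a) ^ (k+1) := by
  obtain ⟨R, hR0, hR⟩ := radau_bound (k+1)
  refine ⟨R, hR0, fun a b hab g A hg hA => ?_⟩
  have hA0 : 0 ≤ A := (abs_nonneg _).trans (hA a ⟨le_rfl, hab.le⟩)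
  set q : ℝ[X] := ∑ i ∈ Finset.range (k+1),
    C (((i.factorial : ℝ))⁻¹ * iteratedDerivWithin i g (Set.Icc a b) a) * (X - C a) ^ i with hq
  have hqd : q.natDegree ≤ k := by
    refine natDegree_sum_le_of_forall_le _ _ fun i hi => ?_
    refine (natDegree_C_mul_le _ _).trans ?_
    refine (natDegree_pow_le_of_le i (natDegree_X_sub_C_le a)).trans ?_
    have := Finset.mem_range.1 hi
    omega
  have hqe : ∀ x, q.eval x = taylorWithinEval g k (Set.Icc a b) a x := by
    intro x
    rw [taylor_within_apply, hq, eval_finsetSum]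
    refine Finset.sum_congr rfl fun i _ => ?_
    simp
    ring
  have hrem : ∀ x ∈ Set.Icc a b, |g x - q.eval x| ≤ A * (b - a) ^ (k+1) := by
    intro x hx
    have h := taylor_mean_remainder_bound (n := k) (C := A) hab.le (hg.contDiffOn) hx (by
      intro y hy
      rw [iteratedDerivWithin_eq_iteratedDeriv (uniqueDiffOn_Icc hab)
        (by exact_mod_cast hg.contDiffAt) hy]
      exact hA y hy)
    rw [Real.norm_eq_abs, ← hqe] at h
    refine h.trans ?_
    have h1 : (x - a) ^ (k+1) ≤ (b - a) ^ (k+1) :=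
      pow_le_pow_left₀ (by linarith [hx.1]) (by linarith [hx.2]) _
    have h2 : (1:ℝ) ≤ (k.factorial : ℝ) := by exact_mod_cast Nat.succ_le_of_lt k.factorial_pos
    have h3 : 0 ≤ A * (x - a) ^ (k+1) :=
      mul_nonneg hA0 (pow_nonneg (by linarith [hx.1]) _)
    exact (div_le_self h3 h2).trans (mul_le_mul_of_nonneg_left h1 hA0)
  have h1 := hR a b hab (fun x => g x - q.eval x) _ (hg.continuous.sub q.continuous) hrem
    (k+1) le_rfl
  have h0 := radauCoeff_poly hab k q hqd
  rw [radauCoeff_eq _ _ _ q.continuous] at h0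
  rw [radauCoeff_eq _ _ _ hg.continuous]
  have h2 : ∀ l, legCoef a b (fun x => g x - q.eval x) l
      = legCoef a b g l - legCoef a b (fun x => q.eval x) l := by
    intro l
    unfold legCoef
    rw [← mul_sub, ← intervalIntegral.integral_sub]
    · congr 2; funext x; ring
    · exact Continuous.intervalIntegrable (by have := hg.continuous; fun_prop) _ _
    · exact Continuous.intervalIntegrable (by fun_prop) _ _
  simp only [h2, Finset.sum_sub_distrib] at h1
  rw [mul_assoc]
  convert h1 using 2
  linarith

/-- inverse estimate at the right end point -/
theorem inverse_est (k : ℕ) : ∃ B : ℝ, 0 ≤ B ∧ ∀ a b : ℝ, a < b → ∀ p : ℝ[X], p.natDegree ≤ k →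
    (p.eval b) ^ 2 ≤ B / (b - a) * ∫ x in a..b, p.eval x * p.eval x := by
  refine ⟨(k + 1) * (2 * k + 1), by positivity, fun a b hab p hp => ?_⟩
  have hpos : 0 < b - a := by linarith
  have h := legC_expand hab k p hp
  set c := legCoef a b (fun x => p.eval x) with hc
  have hb := congrArg (eval b) h
  simp only [eval_finsetSum, eval_mul, eval_C, legC_b hab, mul_one] at hb
  have hI : ∫ x in a..b, p.eval x * p.eval x
      = ∑ l ∈ Finset.range (k+1), c l ^ 2 * ((b - a) / (2 * (l:ℝ) + 1)) := by
    have e : ∀ x, p.eval x * p.eval x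
        = ∑ l ∈ Finset.range (k+1), c l * (p.eval x * (legC a b l).eval x) := by
      intro x
      conv_lhs => rw [h]
      rw [eval_finsetSum]
      rw [Finset.sum_mul]
      refine Finset.sum_congr rfl fun l _ => ?_
      have := congrArg (eval x) h
      rw [eval_finsetSum] at this
      rw [← this, eval_mul, eval_C]
      ring
    simp only [e]
    rw [intervalIntegral.integral_finsetSum]
    · refine Finset.sum_congr rfl fun l _ => ?_
      rw [intervalIntegral.integral_const_mul]
      have : c l = (2 * (l:ℝ) + 1) / (b - a) * ∫ x in a..b, p.eval x * (legC a b l).eval x := rfl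
      have h2 : ∫ x in a..b, p.eval x * (legC a b l).eval x
        = c l * ((b - a) / (2 * (l:ℝ) + 1)) := by rw [this]; field_simp
      rw [h2]; ring
    · intro i _
      exact Continuous.intervalIntegrable (by fun_prop) _ _
  have h1 : (∑ l ∈ Finset.range (k+1), c l) ^ 2 ≤ (k+1) * ∑ l ∈ Finset.range (k+1), c l ^ 2 := by
    have := sq_sum_le_card_mul_sum_sq (s := Finset.range (k+1)) (f := c)
    simpa using this
  rw [hb]
  refine h1.trans ?_
  rw [hI, mul_div_assoc, mul_assoc, Finset.mul_sum (a := (2 * (k:ℝ) + 1) / (b - a))]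
  refine mul_le_mul_of_nonneg_left (Finset.sum_le_sum fun l hl => ?_)
    (by positivity : (0:ℝ) ≤ (k:ℝ) + 1)
  have hl' : (l:ℝ) ≤ k := by
    have h7 : l ≤ k := by have := Finset.mem_range.1 hl; omega
    exact_mod_cast h7
  have e2 : (2 * (k:ℝ) + 1) / (b - a) * (c l ^ 2 * ((b - a) / (2 * (l:ℝ) + 1)))
      = c l ^ 2 * ((2 * (k:ℝ) + 1) / (2 * (l:ℝ) + 1)) := by field_simp
  rw [e2]
  refine le_mul_of_one_le_right (sq_nonneg _) ?_
  rw [le_div_iff₀ (by positivity)]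
  linarith

/-- correction polynomials, with index zero added -/
noncomputable def Phi (k : ℕ) (a b : ℝ) (F : ℕ → ℝ[X]) (i : ℕ) : ℝ[X] :=
  if i = 0 then -legC a b k else F i

theorem Dinv_hasDeriv (a b : ℝ) (p : ℝ[X]) (x : ℝ) :
    HasDerivAt (Dinv a b (fun x => p.eval x)) (2 / (b - a) * p.eval x) x := by
  unfold Dinv
  exact (intervalIntegral.integral_hasDerivAt_right (poly_ii p a x)
    (p.continuous.stronglyMeasurableAtFilter _ _) p.continuous.continuousAt).const_mul _

theorem Dinv_cont (a b : ℝ) (p : ℝ[X]) : Continuous (Dinv a b (fun x => p.eval x)) :=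
  continuous_iff_continuousAt.2 fun x => (Dinv_hasDeriv a b p x).continuousAt

theorem Dinv_bound {a b : ℝ} (hab : a < b) (p : ℝ[X]) (A : ℝ)
    (hA : ∀ x ∈ Set.Icc a b, |p.eval x| ≤ A) :
    ∀ x ∈ Set.Icc a b, |Dinv a b (fun x => p.eval x) x| ≤ 2 * A := by
  intro x hx
  have hA0 : 0 ≤ A := (abs_nonneg _).trans (hA a ⟨le_rfl, hab.le⟩)
  have hpos : 0 < b - a := by linarith
  have h1 : |∫ t in a..x, p.eval t| ≤ A * |x - a| := by
    rw [← Real.norm_eq_abs]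
    refine intervalIntegral.norm_integral_le_of_norm_le_const fun y hy => ?_
    rw [Set.uIoc_of_le hx.1] at hy
    exact hA y ⟨hy.1.le, hy.2.trans hx.2⟩
  rw [abs_of_nonneg (a := x - a) (by linarith [hx.1])] at h1
  unfold Dinv
  rw [abs_mul, abs_of_pos (by positivity)]
  calc _ ≤ 2 / (b - a) * (A * (b - a)) := by
        have : A * (x - a) ≤ A * (b - a) := mul_le_mul_of_nonneg_left (by linarith [hx.2]) hA0
        gcongr
        exact h1.trans this
    _ = _ := by field_simp

theorem phi_gr {k : ℕ} {a b : ℝ} {F : ℕ → ℝ[X]} (hF : IsFSeq k a b F) (i : ℕ) :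
    IsGRProj k a b (Dinv a b (fun x => (Phi k a b F i).eval x)) (-(Phi k a b F (i+1))) := by
  rcases Nat.eq_zero_or_pos i with h0 | hpos
  · subst h0
    have h := hF.1
    simp only [Phi, if_true, zero_add, one_ne_zero, if_false]
    have e : Dinv a b (fun x => (-legC a b k).eval x) = fun x => -Dinv a b (legendreCell k a b) x := by
      funext x
      unfold Dinv
      simp only [eval_neg, legC_eval, intervalIntegral.integral_neg]
      ring
    rw [e]
    refine ⟨by rw [natDegree_neg]; exact h.1, fun v hv => ?_, by rw [eval_neg, h.2.2]⟩
    have := h.2.1 v hv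
    simp only [eval_neg, neg_mul, intervalIntegral.integral_neg, this]
  · have h := hF.2 (i+1) (by omega)
    simp only [Phi, Nat.add_sub_cancel] at h ⊢
    rw [if_neg (by omega), if_neg (by omega)]
    exact h

theorem phi_step {k : ℕ} (hk : 1 ≤ k) {a b : ℝ} {p Q : ℝ[X]}
    (h : IsGRProj k a b (Dinv a b (fun x => p.eval x)) (-Q)) (h0 : ∫ x in a..b, p.eval x = 0) :
    Q.eval b = 0 ∧ ∀ v : ℝ[X], v.natDegree ≤ k →
      ∫ x in a..b, Q.eval x * v.derivative.eval x = 2 / (b - a) * ∫ x in a..b, p.eval x * v.eval x := by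
  have hDb : Dinv a b (fun x => p.eval x) b = 0 := by unfold Dinv; rw [h0, mul_zero]
  have hDa : Dinv a b (fun x => p.eval x) a = 0 := by unfold Dinv; simp
  refine ⟨?_, fun v hv => ?_⟩
  · have := h.2.2
    rw [hDb, eval_neg] at this
    linarith
  · have h1 := h.2.1 v.derivative (by have := natDegree_derivative_le v; omega)
    have h2 := integral_mul_deriv_eq_deriv_mul (a := a) (b := b)
      (fun x _ => Dinv_hasDeriv a b p x) (fun x _ => v.hasDerivAt x)
      (Continuous.intervalIntegrable (by fun_prop) _ _) (poly_ii _ _ _)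
    rw [hDb, hDa] at h2
    simp only [eval_neg, neg_mul, intervalIntegral.integral_neg] at h1
    rw [h2] at h1
    simp only [mul_assoc, intervalIntegral.integral_const_mul] at h1
    linarith

theorem exists_primitive (v : ℝ[X]) : ∃ V : ℝ[X], derivative V = v ∧
    V.natDegree ≤ v.natDegree + 1 := by
  refine ⟨∑ i ∈ Finset.range (v.natDegree + 1), C (v.coeff i / (i + 1)) * X ^ (i+1), ?_, ?_⟩
  · rw [derivative_sum]
    conv_rhs => rw [v.as_sum_range_C_mul_X_pow]
    refine Finset.sum_congr rfl fun i _ => ?_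
    rw [derivative_C_mul_X_pow]
    congr 2
    push_cast
    field_simp
  · refine natDegree_sum_le_of_forall_le _ _ fun i hi => ?_
    refine (natDegree_C_mul_X_pow_le _ _).trans ?_
    have := Finset.mem_range.1 hi
    omega

theorem phi_orth {k : ℕ} (hk : 1 ≤ k) {a b : ℝ} (hab : a < b) {F : ℕ → ℝ[X]}
    (hF : IsFSeq k a b F) (i : ℕ) : ∀ v : ℝ[X], v.natDegree + 1 + i ≤ k →
    ∫ x in a..b, (Phi k a b F i).eval x * v.eval x = 0 := by
  induction i with
  | zero =>
    intro v hv
    simp only [Phi, if_true, eval_neg, neg_mul, intervalIntegral.integral_neg]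
    rw [legC_orth hab k v (by omega), neg_zero]
  | succ n ih =>
    intro v hv
    obtain ⟨V, hV, hVd⟩ := exists_primitive v
    have h0 := ih 1 (by simp; omega)
    simp only [eval_one, mul_one] at h0
    have h1 := (phi_step hk (phi_gr hF n) h0).2 V (by omega)
    rw [hV, ih V (by omega), mul_zero] at h1
    exact h1

theorem phi_rel {k : ℕ} (hk : 1 ≤ k) {a b : ℝ} (hab : a < b) {F : ℕ → ℝ[X]}
    (hF : IsFSeq k a b F) (i : ℕ) (hi : i < k) : (Phi k a b F (i+1)).eval b = 0 ∧
    ∀ v : ℝ[X], v.natDegree ≤ k →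
      ∫ x in a..b, (Phi k a b F (i+1)).eval x * v.derivative.eval x
        = 2 / (b - a) * ∫ x in a..b, (Phi k a b F i).eval x * v.eval x := by
  have h0 := phi_orth hk hab hF i 1 (by simp; omega)
  simp only [eval_one, mul_one] at h0
  exact phi_step hk (phi_gr hF i) h0

theorem phi_natDegree {k : ℕ} {a b : ℝ} {F : ℕ → ℝ[X]} (hF : IsFSeq k a b F) (i : ℕ) :
    (Phi k a b F i).natDegree ≤ k := by
  rcases i with _ | n
  · simp only [Phi, if_true, natDegree_neg]; exact legC_natDegree a b k
  · have := (phi_gr hF n).1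
    rwa [natDegree_neg] at this

theorem phi_bound (k i : ℕ) : ∃ B : ℝ, 0 ≤ B ∧ ∀ a b : ℝ, a < b → ∀ F : ℕ → ℝ[X],
    IsFSeq k a b F → ∀ x ∈ Set.Icc a b, |(Phi k a b F i).eval x| ≤ B := by
  induction i with
  | zero =>
    obtain ⟨B, hB0, hB⟩ := legC_bound k
    refine ⟨B, hB0, fun a b hab F _ x hx => ?_⟩
    simp only [Phi, if_true, eval_neg, abs_neg]
    exact hB a b hab x hx
  | succ n ih =>
    obtain ⟨B, hB0, hB⟩ := ih
    obtain ⟨R, hR0, hR⟩ := gr_bound k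
    refine ⟨R * (2 * B), by positivity, fun a b hab F hF x hx => ?_⟩
    have := hR a b hab _ _ (Dinv_cont a b _) (Dinv_bound hab _ B (hB a b hab F hF)) _
      (phi_gr hF n) x hx
    rwa [eval_neg, abs_neg] at this

end Radau

open MeasureTheory intervalIntegral

section Time
open Polynomial

theorem hasDeriv_int (a b : ℝ) (f f' q : ℝ → ℝ) (hf : ∀ x, HasDerivAt f (f' x) x)
    (hf' : Continuous f') (hq : Continuous q) (s : ℝ) :
    HasDerivAt (fun s => ∫ x in a..b, f (x - s) * q x) (∫ x in a..b, -f' (x - s) * q x) s := by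
  have hfc : Continuous f := continuous_iff_continuousAt.2 fun x => (hf x).continuousAt
  have hK : IsCompact (Set.Icc (s-1) (s+1) ×ˢ Set.uIcc a b) := isCompact_Icc.prod isCompact_uIcc
  obtain ⟨B, hB⟩ := hK.exists_bound_of_continuousOn
    (f := fun z : ℝ × ℝ => -f' (z.2 - z.1) * q z.2) (Continuous.continuousOn (by fun_prop))
  refine (hasDerivAt_integral_of_dominated_loc_of_deriv_le (μ := volume) (a := a) (b := b)
    (F := fun s x => f (x - s) * q x) (F' := fun s x => -f' (x - s) * q x) (x₀ := s)
    (s := Set.Icc (s-1) (s+1)) (bound := fun _ => B) ?_ ?_ ?_ ?_ ?_ ?_ ?_).2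
  · exact Icc_mem_nhds (by linarith) (by linarith)
  · exact Filter.Eventually.of_forall fun x =>
      (Continuous.aestronglyMeasurable (by fun_prop))
  · exact Continuous.intervalIntegrable (by fun_prop) _ _
  · exact (Continuous.aestronglyMeasurable (by fun_prop))
  · refine Filter.Eventually.of_forall fun t ht x hx => ?_
    exact hB (x, t) ⟨hx, Set.uIoc_subset_uIcc ht⟩
  · exact intervalIntegrable_const
  · refine Filter.Eventually.of_forall fun t _ x _ => ?_
    have h1 : HasDerivAt (fun x => t - x) (-1) x := by
      simpa using (hasDerivAt_id x).const_sub t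
    have h2 := ((hf (t - x)).comp x h1).mul_const (q t)
    simpa using h2

theorem radau_hasDeriv (a b : ℝ) (f f' : ℝ → ℝ) (hf : ∀ x, HasDerivAt f (f' x) x)
    (hf' : Continuous f') (m : ℕ) (s : ℝ) :
    HasDerivAt (fun s => radauCoeff a b (fun y => f (y - s)) m)
      (-radauCoeff a b (fun y => f' (y - s)) m) s := by
  unfold radauCoeff
  have hq : Continuous fun x => ∑ l ∈ Finset.range m, (2 * (l:ℝ) + 1) * legendreCell l a b x := by
    simp only [← legC_eval]
    fun_prop
  have h1 := hasDeriv_int a b f f' _ hf hf' hq s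
  have h2 : HasDerivAt (fun x => b - x) (-1) s := by
    simpa using (hasDerivAt_id s).const_sub b
  have h3 := (hf (b - s)).comp s h2
  have h4 := h3.sub (h1.const_mul (1 / (b - a)))
  refine h4.congr_deriv ?_
  simp only [neg_mul, intervalIntegral.integral_neg]
  ring

theorem iter_hasDeriv {n : ℕ} {u0 : ℝ → ℝ} (hu : ContDiff ℝ n u0) (i : ℕ) (hi : i < n) (x : ℝ) :
    HasDerivAt (iteratedDeriv i u0) (iteratedDeriv (i+1) u0 x) x := by
  rw [iteratedDeriv_succ]
  exact (hu.differentiable_iteratedDeriv i (by exact_mod_cast hi) x).hasDerivAt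

theorem Gfun_eq {n : ℕ} {u0 : ℝ → ℝ} (hu : ContDiff ℝ n u0) (k : ℕ) (a b : ℝ) (i : ℕ)
    (hi : i ≤ n) : Gfun k a b u0 i = fun t =>
      (-1) ^ i * radauCoeff a b (fun y => iteratedDeriv i u0 (y - t)) (k+1) := by
  induction i with
  | zero => funext t; simp [Gfun]
  | succ m ih =>
    have ih' := ih (by omega)
    funext t
    have e : Gfun k a b u0 (m+1) t = deriv (Gfun k a b u0 m) t := by
      unfold Gfun; rw [iteratedDeriv_succ]
    rw [e, ih']
    have h := (radau_hasDeriv a b (iteratedDeriv m u0) (iteratedDeriv (m+1) u0)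
      (iter_hasDeriv hu m (by omega))
      (hu.continuous_iteratedDeriv (m+1) (by exact_mod_cast hi)) (k+1) t).const_mul ((-1:ℝ)^m)
    rw [h.deriv, pow_succ]
    ring

theorem Gfun_hasDeriv {n : ℕ} {u0 : ℝ → ℝ} (hu : ContDiff ℝ n u0) (k : ℕ) (a b : ℝ) (i : ℕ)
    (hi : i < n) (t : ℝ) : HasDerivAt (Gfun k a b u0 i) (Gfun k a b u0 (i+1) t) t := by
  rw [Gfun_eq hu k a b i hi.le, Gfun_eq hu k a b (i+1) hi]
  refine ((radau_hasDeriv a b (iteratedDeriv i u0) (iteratedDeriv (i+1) u0)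
      (iter_hasDeriv hu i hi)
      (hu.continuous_iteratedDeriv (i+1) (by exact_mod_cast hi)) (k+1) t).const_mul
      ((-1:ℝ)^i)).congr_deriv ?_
  ring

/-- A time dependent polynomial that is pointwise differentiable in time has a polynomial
time derivative. -/
theorem poly_time (k : ℕ) (p : ℝ → ℝ[X]) (hd : ∀ t, (p t).natDegree ≤ k)
    (hp : ∀ y, Differentiable ℝ fun t => (p t).eval y) :
    ∃ p' : ℝ → ℝ[X], (∀ t, (p' t).natDegree ≤ k) ∧
      (∀ t i, HasDerivAt (fun s => (p s).coeff i) ((p' t).coeff i) t) := by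
  have hcoef : ∀ i, Differentiable ℝ fun t => (p t).coeff i := by
    intro i
    have hinj : Set.InjOn (fun n : ℕ => (n:ℝ)) (Finset.range (k+1)) :=
      fun x _ y _ h => Nat.cast_injective h
    have e : ∀ t, (p t).coeff i = ∑ m ∈ Finset.range (k+1),
        (p t).eval (m:ℝ) * (Lagrange.basis (Finset.range (k+1)) (fun n : ℕ => (n:ℝ)) m).coeff i := by
      intro t
      have h1 : (p t).degree < (Finset.range (k+1)).card := by
        rw [Finset.card_range]
        exact lt_of_le_of_lt degree_le_natDegree
          (by exact_mod_cast Nat.lt_succ_of_le (hd t))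
      have h2 := Lagrange.eq_interpolate hinj h1
      conv_lhs => rw [h2, Lagrange.interpolate_apply, finsetSum_coeff]
      exact Finset.sum_congr rfl fun m _ => by rw [coeff_C_mul]
    simp only [e]
    exact Differentiable.fun_sum fun m _ => (hp m).mul_const _
  refine ⟨fun t => ∑ i ∈ Finset.range (k+1), C (deriv (fun s => (p s).coeff i) t) * X ^ i, ?_, ?_⟩
  · intro t
    refine natDegree_sum_le_of_forall_le _ _ fun i hi => ?_
    refine (natDegree_C_mul_X_pow_le _ _).trans ?_
    have := Finset.mem_range.1 hi
    omega
  · intro t i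
    have e : (∑ i ∈ Finset.range (k+1), C (deriv (fun s => (p s).coeff i) t) * X ^ i).coeff i
        = deriv (fun s => (p s).coeff i) t := by
      rw [finsetSum_coeff]
      simp only [coeff_C_mul_X_pow]
      by_cases hi : i ∈ Finset.range (k+1)
      · rw [Finset.sum_eq_single_of_mem i hi]
        · simp
        · intro j _ hj; rw [if_neg (Ne.symm hj)]
      · rw [Finset.sum_eq_zero]
        · have : (fun s => (p s).coeff i) = fun _ => (0:ℝ) := by
            funext s
            refine coeff_eq_zero_of_natDegree_lt ?_
            have := hd s
            have := Finset.mem_range.not.1 hi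
            omega
          rw [this]; simp
        · intro j hj
          rw [if_neg]
          rintro rfl
          exact hi hj
    rw [e]
    exact (hcoef i t).hasDerivAt

theorem poly_time_eval (k : ℕ) (p p' : ℝ → ℝ[X]) (hd : ∀ t, (p t).natDegree ≤ k)
    (hd' : ∀ t, (p' t).natDegree ≤ k)
    (h : ∀ t i, HasDerivAt (fun s => (p s).coeff i) ((p' t).coeff i) t) (y t : ℝ) :
    HasDerivAt (fun s => (p s).eval y) ((p' t).eval y) t := by
  have e : ∀ q : ℝ → ℝ[X], (∀ t, (q t).natDegree ≤ k) → ∀ s, (q s).eval y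
      = ∑ i ∈ Finset.range (k+1), (q s).coeff i * y ^ i :=
    fun q hq s => eval_eq_sum_range' (Nat.lt_succ_of_le (hq s)) y
  simp only [e p hd, e p' hd']
  exact HasDerivAt.fun_sum fun i _ => (h t i).mul_const _

theorem poly_int (k : ℕ) (p q : ℝ[X]) (hp : p.natDegree ≤ k) (a b : ℝ) :
    ∫ x in a..b, p.eval x * q.eval x
      = ∑ i ∈ Finset.range (k+1), p.coeff i * ∫ x in a..b, x ^ i * q.eval x := by
  simp only [eval_eq_sum_range' (Nat.lt_succ_of_le hp), Finset.sum_mul]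
  rw [intervalIntegral.integral_finsetSum]
  · refine Finset.sum_congr rfl fun i _ => ?_
    simp only [mul_assoc]
    rw [intervalIntegral.integral_const_mul]
  · intro i _
    exact Continuous.intervalIntegrable (by fun_prop) _ _

theorem poly_time_int (k : ℕ) (p p' : ℝ → ℝ[X]) (hd : ∀ t, (p t).natDegree ≤ k)
    (hd' : ∀ t, (p' t).natDegree ≤ k)
    (h : ∀ t i, HasDerivAt (fun s => (p s).coeff i) ((p' t).coeff i) t) (v : ℝ[X]) (a b t : ℝ) :
    HasDerivAt (fun s => ∫ x in a..b, (p s).eval x * v.eval x)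
      (∫ x in a..b, (p' t).eval x * v.eval x) t := by
  simp only [poly_int k _ v (hd _), poly_int k _ v (hd' _)]
  exact HasDerivAt.fun_sum fun i _ => (h t i).mul_const _

theorem poly_time_sq (k : ℕ) (p p' : ℝ → ℝ[X]) (hd : ∀ t, (p t).natDegree ≤ k)
    (hd' : ∀ t, (p' t).natDegree ≤ k)
    (h : ∀ t i, HasDerivAt (fun s => (p s).coeff i) ((p' t).coeff i) t) (a b t : ℝ) :
    HasDerivAt (fun s => ∫ x in a..b, (p s).eval x * (p s).eval x)
      (2 * ∫ x in a..b, (p' t).eval x * (p t).eval x) t := by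
  have key : ∀ s i, (∫ x in a..b, x ^ i * (p s).eval x)
      = ∫ x in a..b, (p s).eval x * (X ^ i : ℝ[X]).eval x := by
    intro s i; congr 1; funext x; simp; ring
  have h1 : HasDerivAt (fun s => ∑ i ∈ Finset.range (k+1), (p s).coeff i *
      ∫ x in a..b, (p s).eval x * (X ^ i : ℝ[X]).eval x)
      (∑ i ∈ Finset.range (k+1), ((p' t).coeff i * (∫ x in a..b, (p t).eval x * (X ^ i : ℝ[X]).eval x)
        + (p t).coeff i * ∫ x in a..b, (p' t).eval x * (X ^ i : ℝ[X]).eval x)) t :=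
    HasDerivAt.fun_sum fun i _ => (h t i).mul (poly_time_int k p p' hd hd' h (X ^ i) a b t)
  have e : (fun s => ∫ x in a..b, (p s).eval x * (p s).eval x) = fun s =>
      ∑ i ∈ Finset.range (k+1), (p s).coeff i *
      ∫ x in a..b, (p s).eval x * (X ^ i : ℝ[X]).eval x := by
    funext s
    rw [poly_int k _ (p s) (hd s)]
    simp only [key]
  rw [e]
  refine h1.congr_deriv ?_
  rw [Finset.sum_add_distrib, two_mul]
  congr 1
  · rw [poly_int k _ (p t) (hd' t)]
    simp only [key]
  · simp only [mul_comm (eval _ (p' t))]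
    rw [poly_int k _ (p' t) (hd t)]
    simp

/-- Gronwall type lemma -/
theorem sqrt_energy (E E' : ℝ → ℝ) (T ρ : ℝ) (hρ : 0 ≤ ρ) (hE : ∀ t, HasDerivAt E (E' t) t)
    (h0 : E 0 = 0) (hpos : ∀ t, 0 ≤ E t)
    (hb : ∀ t ∈ Set.Icc (0:ℝ) T, E' t ≤ 2 * (ρ * Real.sqrt (E t))) :
    ∀ t ∈ Set.Icc (0:ℝ) T, Real.sqrt (E t) ≤ ρ * t := by
  intro t ht
  refine le_of_forall_pos_le_add fun ε hε => ?_
  have hg : ∀ s, HasDerivAt (fun s => Real.sqrt (E s + ε ^ 2) - ρ * s)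
      (E' s / (2 * Real.sqrt (E s + ε ^ 2)) - ρ) s := by
    intro s
    have h1 := ((hE s).add_const (ε ^ 2)).sqrt (by have := hpos s; positivity)
    have h2 := (hasDerivAt_id s).const_mul ρ
    exact (h1.fun_sub h2).congr_deriv (by ring)
  have hanti : AntitoneOn (fun s => Real.sqrt (E s + ε ^ 2) - ρ * s) (Set.Icc 0 T) := by
    refine antitoneOn_of_deriv_nonpos (convex_Icc 0 T)
      (fun s _ => (hg s).continuousAt.continuousWithinAt)
      (fun s _ => (hg s).differentiableAt.differentiableWithinAt) ?_
    intro s hs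
    rw [interior_Icc] at hs
    rw [(hg s).deriv]
    have hsp : 0 < Real.sqrt (E s + ε ^ 2) := Real.sqrt_pos.2 (by have := hpos s; positivity)
    have h3 : Real.sqrt (E s) ≤ Real.sqrt (E s + ε ^ 2) := Real.sqrt_le_sqrt (by nlinarith)
    have h4 := hb s ⟨hs.1.le, hs.2.le⟩
    rw [sub_nonpos, div_le_iff₀ (by positivity)]
    nlinarith [mul_le_mul_of_nonneg_left h3 hρ]
  have h5 := hanti ⟨le_rfl, ht.1.trans ht.2⟩ ht ht.1
  simp only [h0, zero_add, mul_zero, sub_zero, Real.sqrt_sq hε.le] at h5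
  have h6 : Real.sqrt (E t) ≤ Real.sqrt (E t + ε ^ 2) := Real.sqrt_le_sqrt (by nlinarith)
  linarith

end Time

open MeasureTheory intervalIntegral

section Cell
open Polynomial

theorem G_bound (k : ℕ) : ∃ B : ℝ, 0 ≤ B ∧ ∀ a b : ℝ, a < b → ∀ (u0 : ℝ → ℝ) (M t : ℝ),
    ContDiff ℝ (2*k+2 : ℕ) u0 → (∀ y ∈ Set.Icc a b, |iteratedDeriv (2*k+2) u0 (y - t)| ≤ M) →
      |Gfun k a b u0 (k+1) t| ≤ B * M * (b - a) ^ (k+1) := by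
  obtain ⟨B, hB0, hB⟩ := radau_taylor k
  refine ⟨B, hB0, fun a b hab u0 M t hu hM => ?_⟩
  rw [Gfun_eq hu k a b (k+1) (by omega)]
  simp only [abs_mul, abs_pow, abs_neg, abs_one, one_pow, one_mul]
  have hcd : ContDiff ℝ (k+1 : ℕ) (iteratedDeriv (k+1) u0) := by
    rw [iteratedDeriv_eq_iterate]
    refine ContDiff.iterate_deriv' (k+1) (k+1) ?_
    have : k + 1 + (k + 1) = 2 * k + 2 := by ring
    rw [this]; exact hu
  refine hB a b hab _ M ?_ ?_
  · have h1 : ContDiff ℝ (k+1 : ℕ) (fun y => iteratedDeriv (k+1) u0 (y - t)) :=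
      hcd.comp (contDiff_id.sub contDiff_const)
    exact_mod_cast h1
  · intro y hy
    rw [iteratedDeriv_comp_sub_const]
    have : iteratedDeriv (k+1) (iteratedDeriv (k+1) u0) = iteratedDeriv (2*k+2) u0 := by
      simp only [iteratedDeriv_eq_iterate]
      rw [← Function.iterate_add_apply]
      congr 1
      ring
    rw [this]
    exact hM y hy

/-- The polynomial form of the correction function. -/
noncomputable def wPoly (k : ℕ) (a b : ℝ) (u0 : ℝ → ℝ) (F : ℕ → ℝ[X]) (d : ℕ) (t : ℝ) : ℝ[X] :=
  ∑ i ∈ Finset.range k,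
    C (((b - a) / 2) ^ (i+1) * Gfun k a b u0 (i+1+d) t) * Phi k a b F (i+1)

theorem sum_shift (f : ℕ → ℝ) (k : ℕ) :
    ∑ i ∈ Finset.range k, f (i+1) = ∑ i ∈ Finset.Icc 1 k, f i := by
  induction k with
  | zero => simp
  | succ n ih => rw [Finset.sum_Icc_succ_top (by omega), Finset.sum_range_succ, ih]

theorem wPoly_eval (k : ℕ) (a b : ℝ) (u0 : ℝ → ℝ) (F : ℕ → ℝ[X]) (t y : ℝ) :
    (wPoly k a b u0 F 0 t).eval y = wSum k a b u0 F k y t := by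
  unfold wPoly wSum wFun
  rw [eval_finsetSum, ← sum_shift]
  refine Finset.sum_congr rfl fun i _ => ?_
  simp [Phi]

theorem wPoly_natDegree {k : ℕ} {a b : ℝ} (u0 : ℝ → ℝ) {F : ℕ → ℝ[X]} (hF : IsFSeq k a b F)
    (d : ℕ) (t : ℝ) : (wPoly k a b u0 F d t).natDegree ≤ k :=
  natDegree_sum_le_of_forall_le _ _ fun _ _ =>
    (natDegree_C_mul_le _ _).trans (phi_natDegree hF _)

theorem P_time {k : ℕ} (hk : 1 ≤ k) {a b : ℝ} (hab : a < b) {u0 : ℝ → ℝ}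
    (hu : ContDiff ℝ (2*k+2 : ℕ) u0) (P : ℝ → ℝ[X])
    (hP : ∀ t, IsGRProj k a b (fun y => u0 (y - t)) (P t)) :
    ∃ P' : ℝ → ℝ[X], (∀ t, (P' t).natDegree ≤ k) ∧
      (∀ t i, HasDerivAt (fun s => (P s).coeff i) ((P' t).coeff i) t) ∧
      ∀ t, ∀ v : ℝ[X], v.natDegree ≤ k → ∫ x in a..b, (P' t).eval x * v.eval x =
        (∫ x in a..b, (P t).eval x * v.derivative.eval x) - u0 (b - t) * v.eval b
          + u0 (a - t) * v.eval a
        + Gfun k a b u0 1 t * ∫ x in a..b, (legC a b k).eval x * v.eval x := by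
  have hd0 : ∀ x, HasDerivAt u0 (deriv u0 x) x := fun x =>
    (hu.differentiable (by norm_num) x).hasDerivAt
  have hc1 : Continuous (deriv u0) := hu.continuous_deriv (by
    have : (1:ℕ) ≤ 2*k+2 := by omega
    exact_mod_cast this)
  have hc0 : Continuous u0 := hu.continuous
  have hintg : ∀ v : ℝ[X], ∀ t, HasDerivAt (fun s => ∫ x in a..b, u0 (x - s) * v.eval x)
      (∫ x in a..b, -deriv u0 (x - t) * v.eval x) t := fun v t =>
    hasDeriv_int a b u0 (deriv u0) _ hd0 hc1 v.continuous t
  have hdiff : ∀ y, Differentiable ℝ fun t => (P t).eval y := by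
    intro y
    have e : ∀ t, (P t).eval y = ∑ l ∈ Finset.range k,
        legCoef a b (fun y => u0 (y - t)) l * (legC a b l).eval y
        + (u0 (b - t) - ∑ l ∈ Finset.range k, legCoef a b (fun y => u0 (y - t)) l)
          * (legC a b k).eval y := by
      intro t
      conv_lhs => rw [gr_expand hab (hP t)]
      simp only [eval_add, eval_finsetSum, eval_mul, eval_C]
    simp only [e]
    have hl : ∀ l, Differentiable ℝ fun t => legCoef a b (fun y => u0 (y - t)) l := by
      intro l t
      unfold legCoef
      exact ((hintg (legC a b l) t).differentiableAt).const_mul _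
    have hub : Differentiable ℝ fun t => u0 (b - t) :=
      (hu.differentiable (by norm_num)).comp (by fun_prop : Differentiable ℝ fun t : ℝ => b - t)
    have hs : Differentiable ℝ fun t => ∑ l ∈ Finset.range k, legCoef a b (fun y => u0 (y - t)) l :=
      Differentiable.fun_sum fun l _ => hl l
    exact (Differentiable.fun_sum fun l _ => (hl l).mul_const _).fun_add
      ((hub.fun_sub hs).mul_const _)
  obtain ⟨P', hd', hco⟩ := poly_time k P (fun t => (hP t).1) hdiff
  refine ⟨P', hd', hco, fun t v hv => ?_⟩
  have h1 := poly_time_int k P P' (fun t => (hP t).1) hd' hco v a b t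
  have hcs : ∀ s, Continuous fun y => u0 (y - s) := fun s => by fun_prop
  have h2 : HasDerivAt (fun s => ∫ x in a..b, (P s).eval x * v.eval x)
      ((∫ x in a..b, -deriv u0 (x - t) * v.eval x)
        + Gfun k a b u0 1 t * ∫ x in a..b, (legC a b k).eval x * v.eval x) t := by
    have e : (fun s => ∫ x in a..b, (P s).eval x * v.eval x) = fun s =>
        (∫ x in a..b, u0 (x - s) * v.eval x)
        + Gfun k a b u0 0 s * ∫ x in a..b, (legC a b k).eval x * v.eval x := by
      funext s
      rw [gr_orth hk hab (hcs s) (hP s) v hv]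
      simp [Gfun]
    rw [e]
    exact (hintg v t).fun_add ((Gfun_hasDeriv hu k a b 0 (by omega) t).mul_const _)
  rw [h1.unique h2]
  have h3 := (hP t).2.1 v.derivative (by have := natDegree_derivative_le v; omega)
  rw [h3]
  have h4 := integral_mul_deriv_eq_deriv_mul (a := a) (b := b) (u := fun x => u0 (x - t))
      (u' := fun x => deriv u0 (x - t))
      (fun x _ => by
        exact HasDerivAt.comp_sub_const x t (hd0 (x - t))) (fun x _ => v.hasDerivAt x)
      (Continuous.intervalIntegrable (by fun_prop) _ _) (poly_ii _ _ _)
  rw [h4]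
  simp only [neg_mul, intervalIntegral.integral_neg]
  ring

theorem cell_identity {k : ℕ} (hk : 1 ≤ k) {a b : ℝ} (hab : a < b) {u0 : ℝ → ℝ}
    (hu : ContDiff ℝ (2*k+2 : ℕ) u0) (P : ℝ → ℝ[X])
    (hP : ∀ t, IsGRProj k a b (fun y => u0 (y - t)) (P t)) {F : ℕ → ℝ[X]}
    (hF : IsFSeq k a b F) (uh : ℝ → ℝ[X]) (hud : ∀ t, (uh t).natDegree ≤ k)
    (huc : ∀ y, ContDiff ℝ 1 fun t => (uh t).eval y) :
    ∃ ξ ξ' : ℝ → ℝ[X], (∀ t, (ξ t).natDegree ≤ k) ∧ (∀ t, (ξ' t).natDegree ≤ k) ∧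
      (∀ t i, HasDerivAt (fun s => (ξ s).coeff i) ((ξ' t).coeff i) t) ∧
      (∀ t y, (ξ t).eval y = (uh t).eval y - uIl k a b u0 P F k y t) ∧
      (∀ t, (ξ t).eval b = (uh t).eval b - u0 (b - t)) ∧
      ∀ t g : ℝ, (∀ v : ℝ[X], v.natDegree ≤ k →
        (∫ y in a..b, deriv (fun s => (uh s).eval y) t * v.eval y)
        - (∫ y in a..b, (uh t).eval y * v.derivative.eval y)
        + (uh t).eval b * v.eval b - g * v.eval a = 0) →
        ∀ v : ℝ[X], v.natDegree ≤ k → ∫ x in a..b, (ξ' t).eval x * v.eval x =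
          (∫ x in a..b, (ξ t).eval x * v.derivative.eval x) - (ξ t).eval b * v.eval b
          + (g - u0 (a - t)) * v.eval a
          + ∫ x in a..b, (C (((b - a) / 2) ^ k * Gfun k a b u0 (k+1) t)
              * Phi k a b F k).eval x * v.eval x := by
  obtain ⟨P', hPd', hPc, hPi⟩ := P_time hk hab hu P hP
  obtain ⟨uh', hud', huco⟩ := poly_time k uh hud fun y => (huc y).differentiable (by norm_num)
  have hder : ∀ t y, deriv (fun s => (uh s).eval y) t = (uh' t).eval y := fun t y =>
    (poly_time_eval k uh uh' hud hud' huco y t).deriv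
  have hne : b - a ≠ 0 := by linarith
  have hξb : ∀ t, (uh t - P t + wPoly k a b u0 F 0 t).eval b = (uh t).eval b - u0 (b - t) := by
    intro t
    have hw : (wPoly k a b u0 F 0 t).eval b = 0 := by
      unfold wPoly
      rw [eval_finsetSum]
      refine Finset.sum_eq_zero fun i hi => ?_
      rw [eval_mul, (phi_rel hk hab hF i (Finset.mem_range.1 hi)).1, mul_zero]
    rw [eval_add, eval_sub, hw, (hP t).2.2, add_zero]
  refine ⟨fun t => uh t - P t + wPoly k a b u0 F 0 t,
    fun t => uh' t - P' t + wPoly k a b u0 F 1 t, ?_, ?_, ?_, ?_, hξb, ?_⟩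
  · intro t
    exact (natDegree_add_le _ _).trans (max_le ((natDegree_sub_le _ _).trans
      (max_le (hud t) (hP t).1)) (wPoly_natDegree u0 hF 0 t))
  · intro t
    exact (natDegree_add_le _ _).trans (max_le ((natDegree_sub_le _ _).trans
      (max_le (hud' t) (hPd' t))) (wPoly_natDegree u0 hF 1 t))
  · intro t i
    simp only [coeff_add, coeff_sub]
    refine ((huco t i).fun_sub (hPc t i)).fun_add ?_
    simp only [wPoly, finsetSum_coeff, coeff_C_mul]
    refine HasDerivAt.fun_sum fun m hm => ?_
    have hm' := Finset.mem_range.1 hm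
    exact ((Gfun_hasDeriv hu k a b (m+1) (by omega) t).const_mul _).mul_const _
  · intro t y
    simp only [eval_add, eval_sub, wPoly_eval, uIl]
    ring
  · intro t g hDG v hv
    have e1 := hDG v hv
    simp only [hder] at e1
    have e2 := hPi t v hv
    have ev : ∀ (A B W q : ℝ[X]), ∫ x in a..b, (A - B + W).eval x * q.eval x
        = (∫ x in a..b, A.eval x * q.eval x) - (∫ x in a..b, B.eval x * q.eval x)
          + ∫ x in a..b, W.eval x * q.eval x := by
      intro A B W q
      rw [← intervalIntegral.integral_sub, ← intervalIntegral.integral_add]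
      · congr 1; funext x; simp; ring
      all_goals exact Continuous.intervalIntegrable (by fun_prop) _ _
    have ew : ∀ (d : ℕ) (q : ℝ[X]), ∫ x in a..b, (wPoly k a b u0 F d t).eval x * q.eval x
        = ∑ i ∈ Finset.range k, (((b - a) / 2) ^ (i+1) * Gfun k a b u0 (i+1+d) t) *
            ∫ x in a..b, (Phi k a b F (i+1)).eval x * q.eval x := by
      intro d q
      simp only [wPoly, eval_finsetSum, eval_mul, eval_C, Finset.sum_mul]
      rw [intervalIntegral.integral_finsetSum]
      · refine Finset.sum_congr rfl fun i _ => ?_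
        rw [← intervalIntegral.integral_const_mul]
        congr 1; funext x; ring
      · intro i _
        exact Continuous.intervalIntegrable (by fun_prop) _ _
    have key : (∫ x in a..b, (wPoly k a b u0 F 1 t).eval x * v.eval x)
        - Gfun k a b u0 1 t * ∫ x in a..b, (legC a b k).eval x * v.eval x
        = (∫ x in a..b, (wPoly k a b u0 F 0 t).eval x * v.derivative.eval x)
          + ((b - a) / 2) ^ k * Gfun k a b u0 (k+1) t *
            ∫ x in a..b, (Phi k a b F k).eval x * v.eval x := by
      set f : ℕ → ℝ := fun i => ((b - a) / 2) ^ i * Gfun k a b u0 (i+1) t *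
            ∫ x in a..b, (Phi k a b F i).eval x * v.eval x with hf
      have s1 : ∫ x in a..b, (wPoly k a b u0 F 1 t).eval x * v.eval x
          = ∑ i ∈ Finset.range k, f (i+1) := by rw [ew]
      have s2 : ∫ x in a..b, (wPoly k a b u0 F 0 t).eval x * v.derivative.eval x
          = ∑ i ∈ Finset.range k, f i := by
        rw [ew]
        refine Finset.sum_congr rfl fun i hi => ?_
        rw [(phi_rel hk hab hF i (Finset.mem_range.1 hi)).2 v hv, hf]
        simp only [add_zero]
        rw [pow_succ]
        field_simp
      have s3 : f 0 = - (Gfun k a b u0 1 t * ∫ x in a..b, (legC a b k).eval x * v.eval x) := by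
        simp [hf, Phi]
      have s4 := Finset.sum_range_succ' f k
      rw [Finset.sum_range_succ] at s4
      rw [s1, s2]
      change _ = _ + f k
      linarith
    have e3 : ∫ x in a..b, (C (((b - a) / 2) ^ k * Gfun k a b u0 (k+1) t)
              * Phi k a b F k).eval x * v.eval x
        = ((b - a) / 2) ^ k * Gfun k a b u0 (k+1) t *
            ∫ x in a..b, (Phi k a b F k).eval x * v.eval x := by
      rw [← intervalIntegral.integral_const_mul]
      congr 1; funext x; rw [eval_mul, eval_C]; ring
    rw [e3]
    simp only [hξb]
    rw [ev, ev]
    linarith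

theorem telesc (f : ℕ → ℝ) (N : ℕ) : ∑ j ∈ Finset.Icc 1 N, (f (j-1) - f j) = f 0 - f N := by
  induction N with
  | zero => simp
  | succ n ih =>
    rw [Finset.sum_Icc_succ_top (by omega), ih]
    simp

end Cell

open MeasureTheory intervalIntegral

theorem quad_disc (A S B : ℝ) (hA : 0 ≤ A) (h : ∀ l : ℝ, 0 ≤ l ^ 2 * A - 2 * l * S + B) :
    S ≤ Real.sqrt B * Real.sqrt A := by
  have h1 := discrim_le_zero (a := A) (b := -2 * S) (c := B) (fun l => by
    have := h l; nlinarith)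
  have hB : 0 ≤ B := by have := h 0; nlinarith
  rw [← Real.sqrt_mul hB]
  refine Real.le_sqrt_of_sq_le ?_
  unfold discrim at h1
  nlinarith

open Polynomial in
theorem cell_quad {a b : ℝ} (hab : a < b) (r p : ℝ[X]) (K : ℝ)
    (hr : ∀ x ∈ Set.Icc a b, |r.eval x| ≤ K) (l : ℝ) :
    0 ≤ l ^ 2 * (∫ x in a..b, p.eval x * p.eval x) - 2 * l * (∫ x in a..b, r.eval x * p.eval x)
      + K ^ 2 * (b - a) := by
  have h1 : 0 ≤ ∫ x in a..b, (l * p.eval x - r.eval x) ^ 2 :=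
    intervalIntegral.integral_nonneg hab.le fun x _ => sq_nonneg _
  have h2 : ∫ x in a..b, r.eval x * r.eval x ≤ ∫ x in a..b, K ^ 2 := by
    refine intervalIntegral.integral_mono_on hab.le
      (Continuous.intervalIntegrable (by fun_prop) _ _) intervalIntegrable_const fun x hx => ?_
    have := hr x hx
    rw [← sq]
    exact sq_le_sq' (abs_le.1 this).1 (abs_le.1 this).2
  rw [intervalIntegral.integral_const, smul_eq_mul] at h2
  have h3 : ∫ x in a..b, (l * p.eval x - r.eval x) ^ 2
      = l ^ 2 * (∫ x in a..b, p.eval x * p.eval x) - 2 * l * (∫ x in a..b, r.eval x * p.eval x)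
        + ∫ x in a..b, r.eval x * r.eval x := by
    rw [← intervalIntegral.integral_const_mul, ← intervalIntegral.integral_const_mul,
      ← intervalIntegral.integral_sub, ← intervalIntegral.integral_add]
    · congr 1; funext x; ring
    all_goals exact Continuous.intervalIntegrable (by fun_prop) _ _
  linarith

theorem stmt13 (k : ℕ) (hk : 1 ≤ k) (c : ℝ) (hc : 1 ≤ c) :
    ∃ C : ℝ, 0 < C ∧
      ∀ (N : ℕ) (x : ℕ → ℝ) (h T : ℝ), 1 ≤ N → x 0 = 0 → x N = 2 * Real.pi →
        (∀ j < N, x j < x (j+1)) →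
        (∀ j ∈ Finset.Icc 1 N, x j - x (j-1) ≤ h) →
        (∀ j ∈ Finset.Icc 1 N, h ≤ c * (x j - x (j-1))) →
        0 < T →
        ∀ u0 : ℝ → ℝ, ContDiff ℝ (2*k+2) u0 →
        ∀ M : ℝ,
          (∀ i ≤ 2*k+2, ∀ y ∈ Set.Icc (-T) (2 * Real.pi), |iteratedDeriv i u0 y| ≤ M) →
        ∀ P : ℕ → ℝ → Polynomial ℝ,
          (∀ j ∈ Finset.Icc 1 N, ∀ t : ℝ,
            IsGRProj k (x (j-1)) (x j) (fun y => u0 (y - t)) (P j t)) →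
        ∀ F : ℕ → ℕ → Polynomial ℝ,
          (∀ j ∈ Finset.Icc 1 N, IsFSeq k (x (j-1)) (x j) (F j)) →
        ∀ (inflow : ℝ → ℝ) (uh : ℕ → ℝ → Polynomial ℝ),
          IsDGSol k N x T inflow uh →
          (((∀ t, inflow t = (uh N t).eval (x N))
              ∧ (∀ y : ℝ, u0 (y + 2 * Real.pi) = u0 y))
            ∨ (∀ t, inflow t = u0 (-t))) →
          (∀ j ∈ Finset.Icc 1 N, ∀ y ∈ Set.Icc (x (j-1)) (x j),
            (uh j 0).eval y = uIl k (x (j-1)) (x j) u0 (P j) (F j) k y 0) →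
        ∀ t ∈ Set.Icc (0:ℝ) T,
          (∀ j ∈ Finset.Icc 1 N,
            |u0 (x j - t) - (uh j t).eval (x j)|
              ≤ C * t * h ^ (2*(k:ℝ) + 1/2) * M)
          ∧ Real.sqrt ((1/(N:ℝ)) * ∑ j ∈ Finset.Icc 1 N,
                (u0 (x j - t) - (uh j t).eval (x j))^2)
              ≤ C * t * h^(2*k+1) * M := by
  obtain ⟨R, hR0, hR⟩ := G_bound k
  obtain ⟨Bp, hBp0, hBp⟩ := phi_bound k k
  obtain ⟨Bi, hBi0, hBi⟩ := inverse_est k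
  have hpi : 0 < 2 * Real.pi := by positivity
  set D : ℝ := 2 * Real.pi * Bi * c * (R * Bp) ^ 2 with hD
  have hD0 : 0 ≤ D := by positivity
  refine ⟨Real.sqrt D + 1, by positivity, ?_⟩
  intro N x h T hN hx0 hxN hxm hh1 hh2 hT u0 hu M hM P hP F hF inflow uh hDG hbc hinit
  have hu' : ContDiff ℝ (2*k+2 : ℕ) u0 := by exact_mod_cast hu
  -- mesh facts
  have hmono : ∀ d i, i + d ≤ N → x i ≤ x (i + d) := by
    intro d
    induction d with
    | zero => intro i _; exact le_rfl
    | succ n ih => intro i hi; exact (ih i (by omega)).trans (hxm (i+n) (by omega)).le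
  have hx_lo : ∀ j ≤ N, 0 ≤ x j := fun j hj => by
    have := hmono j 0 (by omega); rwa [zero_add, hx0] at this
  have hx_hi : ∀ j ≤ N, x j ≤ 2 * Real.pi := fun j hj => by
    have := hmono (N - j) j (by omega); rwa [Nat.add_sub_cancel' hj, hxN] at this
  have hcell : ∀ j ∈ Finset.Icc 1 N, x (j-1) < x j := by
    intro j hj
    rw [Finset.mem_Icc] at hj
    have := hxm (j-1) (by omega)
    rwa [Nat.sub_add_cancel hj.1] at this
  have h1mem : (1:ℕ) ∈ Finset.Icc 1 N := Finset.mem_Icc.2 ⟨le_rfl, hN⟩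
  have hh : 0 < h := by have := hcell 1 h1mem; have := hh1 1 h1mem; linarith
  have hM0 : 0 ≤ M := (abs_nonneg _).trans (hM 0 (by omega) 0 ⟨by linarith, by positivity⟩)
  set K : ℝ := R * Bp * M * h ^ (2*k+1) with hK
  have hK0 : 0 ≤ K := by positivity
  -- cellwise errors
  have hex : ∀ j, ∃ ξ ξ' : ℝ → Polynomial ℝ, j ∈ Finset.Icc 1 N →
      (∀ t, (ξ t).natDegree ≤ k) ∧ (∀ t, (ξ' t).natDegree ≤ k) ∧
      (∀ t i, HasDerivAt (fun s => (ξ s).coeff i) ((ξ' t).coeff i) t) ∧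
      (∀ t y, (ξ t).eval y = (uh j t).eval y - uIl k (x (j-1)) (x j) u0 (P j) (F j) k y t) ∧
      (∀ t, (ξ t).eval (x j) = (uh j t).eval (x j) - u0 (x j - t)) ∧
      ∀ t g : ℝ, (∀ v : Polynomial ℝ, v.natDegree ≤ k →
        (∫ y in (x (j-1))..(x j), deriv (fun s => (uh j s).eval y) t * v.eval y)
        - (∫ y in (x (j-1))..(x j), (uh j t).eval y * v.derivative.eval y)
        + (uh j t).eval (x j) * v.eval (x j) - g * v.eval (x (j-1)) = 0) →
        ∀ v : Polynomial ℝ, v.natDegree ≤ k → ∫ y in (x (j-1))..(x j), (ξ' t).eval y * v.eval y =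
          (∫ y in (x (j-1))..(x j), (ξ t).eval y * v.derivative.eval y)
            - (ξ t).eval (x j) * v.eval (x j)
          + (g - u0 (x (j-1) - t)) * v.eval (x (j-1))
          + ∫ y in (x (j-1))..(x j), (Polynomial.C (((x j - x (j-1)) / 2) ^ k
              * Gfun k (x (j-1)) (x j) u0 (k+1) t)
              * Phi k (x (j-1)) (x j) (F j) k).eval y * v.eval y := by
    intro j
    by_cases hj : j ∈ Finset.Icc 1 N
    · obtain ⟨ξ, ξ', H⟩ := cell_identity hk (hcell j hj) hu' (P j) (hP j hj) (hF j hj) (uh j)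
        (hDG.1 j hj) (hDG.2.1 j hj)
      exact ⟨ξ, ξ', fun _ => H⟩
    · exact ⟨fun _ => 0, fun _ => 0, fun h => absurd h hj⟩
  choose ξ ξ' H using hex
  set E : ℝ → ℝ := fun t => ∑ j ∈ Finset.Icc 1 N,
    ∫ y in (x (j-1))..(x j), (ξ j t).eval y * (ξ j t).eval y with hE
  set E' : ℝ → ℝ := fun t => ∑ j ∈ Finset.Icc 1 N,
    2 * ∫ y in (x (j-1))..(x j), (ξ' j t).eval y * (ξ j t).eval y with hE'
  have hEj : ∀ t, ∀ j ∈ Finset.Icc 1 N,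
      0 ≤ ∫ y in (x (j-1))..(x j), (ξ j t).eval y * (ξ j t).eval y := fun t j hj =>
    intervalIntegral.integral_nonneg (hcell j hj).le fun y _ => mul_self_nonneg _
  have hEpos : ∀ t, 0 ≤ E t := fun t => Finset.sum_nonneg (hEj t)
  have hEd : ∀ t, HasDerivAt E (E' t) t := fun t =>
    HasDerivAt.fun_sum fun j hj => by
      obtain ⟨H1, H2, H3, -⟩ := H j hj
      exact poly_time_sq k (ξ j) (ξ' j) H1 H2 H3 _ _ t
  have hE0 : E 0 = 0 := by
    refine Finset.sum_eq_zero fun j hj => ?_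
    have : ∫ y in (x (j-1))..(x j), (ξ j 0).eval y * (ξ j 0).eval y
        = ∫ y in (x (j-1))..(x j), (0:ℝ) := by
      refine intervalIntegral.integral_congr fun y hy => ?_
      rw [Set.uIcc_of_le (hcell j hj).le] at hy
      have := (H j hj).2.2.2.1 0 y
      rw [hinit j hj y hy, sub_self] at this
      simp [this]
    rw [this]; simp
  have hsumh : ∑ j ∈ Finset.Icc 1 N, (x j - x (j-1)) = 2 * Real.pi := by
    have := telesc (fun j => - x j) N
    simp only [neg_sub_neg] at this
    rw [this, hx0, hxN]; ring
  have hEb : ∀ t ∈ Set.Icc (0:ℝ) T, E' t ≤ 2 * (Real.sqrt (K ^ 2 * (2 * Real.pi)) * Real.sqrt (E t)) := by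
    intro t ht
    set r : ℕ → Polynomial ℝ := fun j => Polynomial.C (((x j - x (j-1)) / 2) ^ k
              * Gfun k (x (j-1)) (x j) u0 (k+1) t) * Phi k (x (j-1)) (x j) (F j) k with hr
    have hrb : ∀ j ∈ Finset.Icc 1 N, ∀ y ∈ Set.Icc (x (j-1)) (x j), |(r j).eval y| ≤ K := by
      intro j hj y hy
      have hjj := Finset.mem_Icc.1 hj
      have hlt := hcell j hj
      have hle := hh1 j hj
      have hpos : 0 < x j - x (j-1) := by linarith
      have b1 := hR (x (j-1)) (x j) hlt u0 M t hu' (fun y hy => hM _ le_rfl _ (by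
        have := hx_lo (j-1) (by omega)
        have := hx_hi j hjj.2
        exact ⟨by linarith [hy.1, ht.2], by linarith [hy.2, ht.1]⟩))
      have b2 := hBp (x (j-1)) (x j) hlt (F j) (hF j hj) y hy
      simp only [hr, Polynomial.eval_mul, Polynomial.eval_C, abs_mul, abs_pow]
      have b3 : |(x j - x (j-1)) / 2| ≤ h := by
        rw [abs_of_pos (by positivity)]; linarith
      have b4 : R * M * (x j - x (j-1)) ^ (k+1) ≤ R * M * h ^ (k+1) := by gcongr
      calc _ ≤ h ^ k * (R * M * h ^ (k+1)) * Bp := by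
            gcongr
            exact b1.trans b4
        _ = K := by rw [hK]; ring
    set e : ℕ → ℝ := fun j => if j = 0 then inflow t - u0 (x 0 - t)
      else (uh j t).eval (x j) - u0 (x j - t) with he
    have hcellE : ∀ j ∈ Finset.Icc 1 N,
        2 * ∫ y in (x (j-1))..(x j), (ξ' j t).eval y * (ξ j t).eval y ≤
          (e (j-1) ^ 2 - e j ^ 2)
          + 2 * ∫ y in (x (j-1))..(x j), (r j).eval y * (ξ j t).eval y := by
      intro j hj
      have hjj := Finset.mem_Icc.1 hj
      obtain ⟨H1, H2, H3, H4, H5, H6⟩ := H j hj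
      have i1 := H6 t _ (hDG.2.2 j hj t ht) (ξ j t) (H1 t)
      have i2 := poly_ibp (ξ j t) (ξ j t) (x (j-1)) (x j)
      have i3 : ∫ y in (x (j-1))..(x j), (ξ j t).derivative.eval y * (ξ j t).eval y
          = ∫ y in (x (j-1))..(x j), (ξ j t).eval y * (ξ j t).derivative.eval y := by
        congr 1; funext y; ring
      rw [i3] at i2
      have ee : e (j-1) = (if j = 1 then inflow t else (uh (j-1) t).eval (x (j-1)))
          - u0 (x (j-1) - t) := by
        simp only [he]
        by_cases h1 : j = 1
        · subst h1; simp
        · rw [if_neg (by omega), if_neg h1]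
      have ej : e j = (ξ j t).eval (x j) := by
        simp only [he]
        rw [if_neg (by omega), H5]
      rw [← ee, ← ej] at i1
      rw [← ej] at i2
      rw [i1]
      simp only [hr]
      nlinarith [sq_nonneg (e (j-1) - (ξ j t).eval (x (j-1)))]
    have hbdry : e 0 ^ 2 - e N ^ 2 ≤ 0 := by
      rcases hbc with ⟨hb1, hb2⟩ | hb
      · have : e 0 = e N := by
          simp only [he, if_true]
          rw [if_neg (by omega), hb1 t, hx0, hxN]
          have := hb2 (0 - t)
          rw [← this]
          congr 2; ring
        rw [this]; simp
      · have : e 0 = 0 := by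
          simp only [he, if_true, hb t, hx0]
          simp
        rw [this]
        have := sq_nonneg (e N)
        linarith
    have hS := quad_disc (E t) (∑ j ∈ Finset.Icc 1 N,
      ∫ y in (x (j-1))..(x j), (r j).eval y * (ξ j t).eval y) (K ^ 2 * (2 * Real.pi)) (hEpos t)
      (fun l => by
        have := Finset.sum_nonneg fun j hj => cell_quad (hcell j hj) (r j) (ξ j t) K (hrb j hj) l
        rw [Finset.sum_add_distrib, Finset.sum_sub_distrib, ← Finset.mul_sum, ← Finset.mul_sum,
          ← Finset.mul_sum, hsumh] at this
        exact this)
    have hsum := Finset.sum_le_sum hcellE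
    rw [Finset.sum_add_distrib, telesc (fun j => e j ^ 2) N,
      ← Finset.mul_sum (f := fun j => ∫ y in (x (j-1))..(x j), (r j).eval y * (ξ j t).eval y)] at hsum
    linarith
  intro t ht
  have hsq := sqrt_energy E E' T _ (Real.sqrt_nonneg _) hEd hE0 hEpos hEb t ht
  have ht0 := ht.1
  have hEt : E t ≤ K ^ 2 * (2 * Real.pi) * t ^ 2 := by
    have h1 := pow_le_pow_left₀ (Real.sqrt_nonneg _) hsq 2
    rwa [Real.sq_sqrt (hEpos t), mul_pow, Real.sq_sqrt (by positivity)] at h1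
  have hpt : ∀ j ∈ Finset.Icc 1 N, (u0 (x j - t) - (uh j t).eval (x j)) ^ 2
      ≤ Bi * c / h * ∫ y in (x (j-1))..(x j), (ξ j t).eval y * (ξ j t).eval y := by
    intro j hj
    have h1 := hBi (x (j-1)) (x j) (hcell j hj) (ξ j t) ((H j hj).1 t)
    rw [(H j hj).2.2.2.2.1 t] at h1
    have h2 : Bi / (x j - x (j-1)) ≤ Bi * c / h := by
      have hpos : 0 < x j - x (j-1) := by linarith [hcell j hj]
      rw [div_le_div_iff₀ hpos hh]
      have := mul_le_mul_of_nonneg_left (hh2 j hj) hBi0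
      linarith
    have h3 := mul_le_mul_of_nonneg_right h2 (hEj t j hj)
    calc _ = ((uh j t).eval (x j) - u0 (x j - t)) ^ 2 := by ring
      _ ≤ _ := h1.trans h3
  have hCsq : D ≤ (Real.sqrt D + 1) ^ 2 := by
    have h1 := Real.sq_sqrt hD0
    have h2 := Real.sqrt_nonneg D
    nlinarith
  have hfac : 0 ≤ Bi * c / h := by positivity
  constructor
  · intro j hj
    have hE1 : ∫ y in (x (j-1))..(x j), (ξ j t).eval y * (ξ j t).eval y ≤ E t :=
      Finset.single_le_sum (hEj t) hj
    refine abs_le_of_sq_le_sq ?_ (by positivity)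
    have hrp : (h ^ (2*(k:ℝ) + 1/2)) ^ 2 = h ^ (4*k+1) := by
      rw [← Real.rpow_natCast, ← Real.rpow_mul hh.le, ← Real.rpow_natCast]
      congr 1
      push_cast; ring
    calc _ ≤ Bi * c / h * (K ^ 2 * (2 * Real.pi) * t ^ 2) :=
          (hpt j hj).trans (mul_le_mul_of_nonneg_left (hE1.trans hEt) hfac)
      _ = D * (t ^ 2 * h ^ (4*k+1) * M ^ 2) := by
          rw [hD, hK]
          have : (h ^ (2*k+1)) ^ 2 = h ^ (4*k+1) * h := by ring
          rw [mul_pow _ (h ^ (2*k+1)), this]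
          field_simp
      _ ≤ (Real.sqrt D + 1) ^ 2 * (t ^ 2 * h ^ (4*k+1) * M ^ 2) := by gcongr
      _ = _ := by rw [← hrp]; ring
  · have hN0 : (0:ℝ) < N := by exact_mod_cast hN
    refine Real.sqrt_le_iff.2 ⟨by positivity, ?_⟩
    have hNh : 2 * Real.pi ≤ N * h := by
      rw [← hsumh]
      refine (Finset.sum_le_sum hh1).trans ?_
      simp
    have hs := Finset.sum_le_sum hpt
    rw [← Finset.mul_sum] at hs
    calc _ ≤ (1 / (N:ℝ)) * (Bi * c / h * (K ^ 2 * (2 * Real.pi) * t ^ 2)) := by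
          refine mul_le_mul_of_nonneg_left (hs.trans ?_) (by positivity)
          exact mul_le_mul_of_nonneg_left hEt hfac
      _ = (2 * Real.pi) / (N * h) * (Bi * c * (R * Bp) ^ 2) * (t ^ 2 * (h ^ (2*k+1)) ^ 2 * M ^ 2) := by
          rw [hK]
          field_simp
      _ ≤ 1 * (Bi * c * (R * Bp) ^ 2) * (t ^ 2 * (h ^ (2*k+1)) ^ 2 * M ^ 2) := by
          have : (2 * Real.pi) / (N * h) ≤ 1 := by
            rw [div_le_one (by positivity)]; exact hNh
          gcongr
      _ ≤ D * (t ^ 2 * (h ^ (2*k+1)) ^ 2 * M ^ 2) := by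
          have h1 : (1:ℝ) ≤ 2 * Real.pi := by linarith [Real.pi_gt_three]
          have h2 : 0 ≤ Bi * c * (R * Bp) ^ 2 := by positivity
          have h3 : 1 * (Bi * c * (R * Bp) ^ 2) ≤ D := by
            rw [hD]; nlinarith
          gcongr
      _ ≤ (Real.sqrt D + 1) ^ 2 * (t ^ 2 * (h ^ (2*k+1)) ^ 2 * M ^ 2) := by gcongr
      _ = _ := by ring
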